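/- Let g be a classical Lie superalgebra and let M be an object of F = F(g, g_0̄). Then M is projective in F if and only if M is injective in F. -/

import Mathlib

/-!
# Framework: Lie superalgebras over ℂ and their supermodules

A ℤ/2-graded vector space is encoded by a carrier together with a pair of complementary
subspaces (`part 0`, `part 1`).  A Lie superalgebra is such a space with a bilinear
bracket which preserves the grading and satisfies the graded antisymmetry and graded
Jacobi identities (stated on homogeneous elements, with the sign `(-1)^{|x||y|}`).
A `g`-supermodule is a graded vector space with an action of `g` satisfying the graded
module axiom; morphisms are arbitrary (not necessarily grading-preserving) supermodule
homomorphisms, encoded by the sign-twisted intertwining condition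
`f(x·m) = x·(σ^{|x|} f (σ^{|x|} m))`, which for homogeneous `f` is exactly
`f(x·m) = (-1)^{|f||x|} x·f(m)`.
`F = F(g, g₀̄)` is the category of finite-dimensional supermodules which are completely
reducible over `g₀̄`, and `C(g, g₀̄)` that of all supermodules which are finitely
semisimple (sums of finite-dimensional simple `g₀̄`-submodules) over `g₀̄`.
-/

noncomputable section

open LinearMap Submodule Module

/-- The sign `(-1)^{ij}` attached to a pair of parities `i j : ℤ/2`. -/
def ssgn (i j : ZMod 2) : ℂ := if i = 1 ∧ j = 1 then -1 else 1

/-- A ℤ/2-graded (super) complex vector space. -/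
structure SuperVS : Type 1 where
  carrier : Type
  [addCommGroup : AddCommGroup carrier]
  [module : Module ℂ carrier]
  part : ZMod 2 → Submodule ℂ carrier
  isCompl : IsCompl (part 0) (part 1)

attribute [instance] SuperVS.addCommGroup SuperVS.module

namespace SuperVS

variable (W : SuperVS)

/-- The projection onto the even part along the odd part. -/
def projEven : W.carrier →ₗ[ℂ] W.carrier :=
  (W.part 0).subtype ∘ₗ (W.part 0).linearProjOfIsCompl (W.part 1) W.isCompl

/-- The projection onto the odd part along the even part. -/
def projOdd : W.carrier →ₗ[ℂ] W.carrier :=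
  (W.part 1).subtype ∘ₗ (W.part 1).linearProjOfIsCompl (W.part 0) W.isCompl.symm

/-- The projection onto the part of parity `p`. -/
def proj (p : ZMod 2) : W.carrier →ₗ[ℂ] W.carrier :=
  if p = 0 then W.projEven else W.projOdd

/-- The parity involution `σ` (identity on the even part, `-1` on the odd part). -/
def pty : W.carrier →ₗ[ℂ] W.carrier := W.projEven - W.projOdd

/-- `σ^i` for a parity `i : ℤ/2`. -/
def ptyPow (i : ZMod 2) : W.carrier →ₗ[ℂ] W.carrier :=
  if i = 0 then LinearMap.id else W.pty

/-- A subspace is graded if it is the (internal direct) sum of its graded pieces;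
equivalently, it is stable under the parity involution. -/
def IsGraded (U : Submodule ℂ W.carrier) : Prop :=
  ∀ m ∈ U, W.pty m ∈ U

end SuperVS

/-- A Lie superalgebra over `ℂ`: a super vector space with a grading-preserving bilinear
bracket satisfying the graded antisymmetry and graded Jacobi identities. -/
structure LieSuperAlgebra extends SuperVS where
  bracket : carrier →ₗ[ℂ] carrier →ₗ[ℂ] carrier
  bracket_grading : ∀ (i j : ZMod 2), ∀ x ∈ part i, ∀ y ∈ part j,
    bracket x y ∈ part (i + j)
  bracket_skew : ∀ (i j : ZMod 2), ∀ x ∈ part i, ∀ y ∈ part j,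
    bracket x y = -(ssgn i j) • bracket y x
  bracket_jacobi : ∀ (i j k : ZMod 2), ∀ x ∈ part i, ∀ y ∈ part j, ∀ z ∈ part k,
    bracket x (bracket y z) = bracket (bracket x y) z + ssgn i j • bracket y (bracket x z)

namespace LieSuperAlgebra

variable (g : LieSuperAlgebra)

/-- A `g`-supermodule: a super vector space with a `g`-action satisfying the graded
module axiom `[x,y]·m = x·(y·m) - (-1)^{|x||y|} y·(x·m)` and preserving the grading. -/
structure SuperModule extends SuperVS where
  act : g.carrier →ₗ[ℂ] carrier →ₗ[ℂ] carrier
  act_grading : ∀ (i j : ZMod 2), ∀ x ∈ g.part i, ∀ m ∈ part j,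
    act x m ∈ part (i + j)
  act_bracket : ∀ (i j : ZMod 2), ∀ x ∈ g.part i, ∀ y ∈ g.part j, ∀ m : carrier,
    act (g.bracket x y) m = act x (act y m) - ssgn i j • act y (act x m)

namespace SuperModule

variable {g}
variable (M N : g.SuperModule)

/-- A subspace stable under the action of the even part `g₀̄`. -/
def IsEvenStable (U : Submodule ℂ M.carrier) : Prop :=
  ∀ x ∈ g.part 0, ∀ m ∈ U, M.act x m ∈ U

/-- A subspace stable under the action of all of `g` (together with gradedness this is a
sub-supermodule). -/
def IsStable (U : Submodule ℂ M.carrier) : Prop :=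
  ∀ x : g.carrier, ∀ m ∈ U, M.act x m ∈ U

/-- A sub-supermodule: a graded `g`-stable subspace. -/
def IsSubSuper (U : Submodule ℂ M.carrier) : Prop :=
  M.toSuperVS.IsGraded U ∧ M.IsStable U

/-- `M` is completely reducible (semisimple) as a module over the even part `g₀̄`:
every `g₀̄`-stable subspace has a `g₀̄`-stable complement. -/
def IsCompletelyReducibleEven : Prop :=
  ∀ U : Submodule ℂ M.carrier, M.IsEvenStable U →
    ∃ U' : Submodule ℂ M.carrier, M.IsEvenStable U' ∧ IsCompl U U'

/-- Membership in the category `F = F(g, g₀̄)`: finite-dimensional and completely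
reducible over `g₀̄`. -/
def MemF : Prop :=
  FiniteDimensional ℂ M.carrier ∧ M.IsCompletelyReducibleEven

/-- Membership in the category `C(g, g₀̄)`: finitely semisimple over `g₀̄`, i.e. the sum
of the finite-dimensional simple `g₀̄`-submodules is everything. -/
def MemC : Prop :=
  sSup {U : Submodule ℂ M.carrier |
      M.IsEvenStable U ∧ FiniteDimensional ℂ U ∧ U ≠ ⊥ ∧
      ∀ U' ≤ U, M.IsEvenStable U' → U' = ⊥ ∨ U' = U} = ⊤

end SuperModule

/-- A homomorphism of `g`-supermodules (not necessarily grading-preserving): a linear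
map satisfying `f(x·m) = x·(σ^{|x|} (f (σ^{|x|} m)))` for `x` homogeneous of parity
`|x|`; for `f` homogeneous this is the usual sign rule `f(x·m) = (-1)^{|f||x|} x·f(m)`. -/
structure SuperHom (M N : g.SuperModule) where
  toLinearMap : M.carrier →ₗ[ℂ] N.carrier
  compat : ∀ (i : ZMod 2), ∀ x ∈ g.part i, ∀ m : M.carrier,
    toLinearMap (M.act x m)
      = N.act x (N.toSuperVS.ptyPow i (toLinearMap (M.toSuperVS.ptyPow i m)))

/-- Two supermodules are isomorphic in the category of `g`-supermodules. -/
def SuperIso (M N : g.SuperModule) : Prop :=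
  ∃ f : g.SuperHom M N, Function.Bijective f.toLinearMap

/-- `P` is a projective object of `F(g, g₀̄)`. -/
def IsProjectiveInF (P : g.SuperModule) : Prop :=
  P.MemF ∧
  ∀ (M N : g.SuperModule), M.MemF → N.MemF →
    ∀ (p : g.SuperHom M N), Function.Surjective p.toLinearMap →
    ∀ (f : g.SuperHom P N),
      ∃ h : g.SuperHom P M, p.toLinearMap ∘ₗ h.toLinearMap = f.toLinearMap

/-- `I` is an injective object of `F(g, g₀̄)`. -/
def IsInjectiveInF (I : g.SuperModule) : Prop :=
  I.MemF ∧
  ∀ (M N : g.SuperModule), M.MemF → N.MemF →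
    ∀ (ι : g.SuperHom M N), Function.Injective ι.toLinearMap →
    ∀ (f : g.SuperHom M I),
      ∃ h : g.SuperHom N I, h.toLinearMap ∘ₗ ι.toLinearMap = f.toLinearMap

/-- A simple supermodule: nonzero, with no proper nonzero sub-supermodule. -/
def IsSimple (S : g.SuperModule) : Prop :=
  (⊥ : Submodule ℂ S.carrier) ≠ ⊤ ∧
  ∀ U : Submodule ℂ S.carrier, S.IsSubSuper U → U = ⊥ ∨ U = ⊤

/-- `g` is a *classical* Lie superalgebra.  (In the paper this means that `g` is finite
dimensional and that there is a connected reductive algebraic group `G₀̄` with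
`Lie(G₀̄) = g₀̄` whose action on `g₁̄` differentiates to the adjoint action; we encode
the resulting representation-theoretic content: `g` is finite dimensional, `g₀̄` is
reductive in the sense that its adjoint action on itself is completely reducible, and
`g₁̄` is a semisimple `g₀̄`-module.) -/
structure IsClassical : Prop where
  finiteDimensional : FiniteDimensional ℂ g.carrier
  even_reducible : ∀ U : Submodule ℂ g.carrier,
    U ≤ g.part 0 → (∀ x ∈ g.part 0, ∀ y ∈ U, g.bracket x y ∈ U) →
    ∃ U', U' ≤ g.part 0 ∧ (∀ x ∈ g.part 0, ∀ y ∈ U', g.bracket x y ∈ U') ∧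
      U ⊓ U' = ⊥ ∧ U ⊔ U' = g.part 0
  odd_reducible : ∀ U : Submodule ℂ g.carrier,
    U ≤ g.part 1 → (∀ x ∈ g.part 0, ∀ y ∈ U, g.bracket x y ∈ U) →
    ∃ U', U' ≤ g.part 1 ∧ (∀ x ∈ g.part 0, ∀ y ∈ U', g.bracket x y ∈ U') ∧
      U ⊓ U' = ⊥ ∧ U ⊔ U' = g.part 1

/-- A Type I (consistent ℤ-)grading `g = g₋₁ ⊕ g₀ ⊕ g₁` with `g₀̄ = g₀` and
`g₁̄ = g₋₁ ⊕ g₁`.  The conditions `[g₁,g₁] = [g₋₁,g₋₁] = 0` and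
`[g₀,g₊₁] ⊆ g₊₁`, `[g₀,g₋₁] ⊆ g₋₁` express compatibility of the ℤ-grading with the
bracket (the remaining compatibilities are automatic). -/
structure TypeIStructure where
  neg : Submodule ℂ g.carrier
  pos : Submodule ℂ g.carrier
  inf_eq_bot : neg ⊓ pos = ⊥
  sup_eq_odd : neg ⊔ pos = g.part 1
  even_neg : ∀ x ∈ g.part 0, ∀ y ∈ neg, g.bracket x y ∈ neg
  even_pos : ∀ x ∈ g.part 0, ∀ y ∈ pos, g.bracket x y ∈ pos
  neg_neg : ∀ x ∈ neg, ∀ y ∈ neg, g.bracket x y = 0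
  pos_pos : ∀ x ∈ pos, ∀ y ∈ pos, g.bracket x y = 0

/-- The support (rank) variety of `M` over an odd abelian (sub)algebra `W ⊆ g₁̄`:
`{x ∈ W | M is not projective as a U(⟨x⟩)-module} ∪ {0}`.  For `x` with `[x,x] = 0` the
module `M` is projective over `U(⟨x⟩) ≅ ℂ[x]/(x²)` precisely when `Ker x = Im x` on `M`. -/
def suppVariety (W : Submodule ℂ g.carrier) (M : g.SuperModule) : Set g.carrier :=
  {x | x ∈ W ∧ LinearMap.ker (M.act x) ≠ LinearMap.range (M.act x)} ∪ {0}

end LieSuperAlgebra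

section LieTheory

variable {L : Type} [LieRing L] [LieAlgebra ℂ L]
  {X : Type} [AddCommGroup X] [Module ℂ X] [LieRingModule L X] [LieModule ℂ L X]

namespace LieModule

/-- The kernel of an endomorphism commuting with the action of `L`. -/
def kerOfCommute (c : Module.End ℂ X) (hc : ∀ x : L, Commute c (toEnd ℂ L X x)) :
    LieSubmodule ℂ L X where
  toSubmodule := LinearMap.ker c
  lie_mem {x m} hm := by
    have h := LinearMap.congr_fun (hc x).eq m
    simp only [Module.End.mul_apply, toEnd_apply_apply] at h
    have hm' : c m = 0 := hm
    change c ⁅x, m⁆ = 0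
    rw [h, hm', lie_zero]

/-- The Casimir endomorphism attached to an ideal on which the trace form is nondegenerate
commutes with `L`. -/
theorem commute_casimir {ι : Type} [Fintype ι] [DecidableEq ι] (D : LieIdeal ℂ L)
    (b b' : Basis ι ℂ D)
    (h1 : ∀ (v : D), v = ∑ i, traceForm ℂ L X v (b' i) • b i)
    (h2 : ∀ (v : D), v = ∑ i, traceForm ℂ L X (b i) v • b' i) (x : L) :
    Commute (∑ i, toEnd ℂ L X (b i) * toEnd ℂ L X (b' i)) (toEnd ℂ L X x) := by
  refine LinearMap.ext fun m ↦ ?_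
  have e1 (i : ι) : ⁅x, (b i : L)⁆ = ∑ j, traceForm ℂ L X ⁅x, (b i : L)⁆ (b' j) • (b j : L) := by
    have := congrArg (Subtype.val) (h1 ⁅x, b i⁆)
    simpa using this
  have e2 (i : ι) : ⁅x, (b' i : L)⁆ = ∑ j, traceForm ℂ L X (b j) ⁅x, (b' i : L)⁆ • (b' j : L) := by
    have := congrArg (Subtype.val) (h2 ⁅x, b' i⁆)
    simpa using this
  have key : ∑ i, ⁅⁅x, (b i : L)⁆, ⁅(b' i : L), m⁆⁆ +
      ∑ i, ⁅(b i : L), ⁅⁅x, (b' i : L)⁆, m⁆⁆ = 0 := by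
    have l1 : ∑ i, ⁅⁅x, (b i : L)⁆, ⁅(b' i : L), m⁆⁆ = ∑ i, ∑ j,
        traceForm ℂ L X ⁅x, (b i : L)⁆ (b' j) • ⁅(b j : L), ⁅(b' i : L), m⁆⁆ := by
      refine Finset.sum_congr rfl fun i _ ↦ ?_
      conv_lhs => rw [e1 i]
      simp [sum_lie]
    have l2 : ∑ i, ⁅(b i : L), ⁅⁅x, (b' i : L)⁆, m⁆⁆ = ∑ i, ∑ j,
        traceForm ℂ L X (b j) ⁅x, (b' i : L)⁆ • ⁅(b i : L), ⁅(b' j : L), m⁆⁆ := by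
      refine Finset.sum_congr rfl fun i _ ↦ ?_
      conv_lhs => rw [e2 i]
      simp [sum_lie, lie_sum]
    rw [l1, l2, Finset.sum_comm, ← Finset.sum_add_distrib]
    refine Finset.sum_eq_zero fun i _ ↦ ?_
    rw [← Finset.sum_add_distrib]
    refine Finset.sum_eq_zero fun j _ ↦ ?_
    rw [traceForm_apply_lie_apply', neg_smul, neg_add_cancel]
  simp only [Module.End.mul_apply, LinearMap.sum_apply, toEnd_apply_apply, lie_sum]
  rw [← sub_eq_zero, ← neg_eq_zero, ← key, neg_sub, ← Finset.sum_sub_distrib,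
    ← Finset.sum_add_distrib]
  refine Finset.sum_congr rfl fun i _ ↦ ?_
  rw [leibniz_lie x (b i : L), leibniz_lie x (b' i : L), lie_add]
  abel

/-- Semisimplicity of the action of an element passes to submodules. -/
theorem isSemisimple_toEnd_submodule (N : LieSubmodule ℂ L X) {z : L}
    (hz : (toEnd ℂ L X z).IsSemisimple) : (toEnd ℂ L N z).IsSemisimple := by
  rw [← LieSubmodule.toEnd_restrict_eq_toEnd N z]
  exact hz.restrict (p := N.toSubmodule) fun v hv ↦ N.lie_mem hv

/-- The linear maps `X → U` which restrict to a scalar on the submodule `U`. -/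
def scalarOn (U : LieSubmodule ℂ L X) : LieSubmodule ℂ L (X →ₗ[ℂ] U) where
  carrier := {T | ∃ c : ℂ, ∀ u : U, T u = c • u}
  add_mem' := by
    rintro S T ⟨c, hc⟩ ⟨d, hd⟩
    exact ⟨c + d, fun u ↦ by rw [LinearMap.add_apply, hc, hd, add_smul]⟩
  zero_mem' := ⟨0, fun u ↦ by simp⟩
  smul_mem' := by
    rintro a T ⟨c, hc⟩
    exact ⟨a * c, fun u ↦ by rw [LinearMap.smul_apply, hc, mul_smul]⟩
  lie_mem := by
    rintro x T ⟨c, hc⟩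
    refine ⟨0, fun u ↦ ?_⟩
    have := hc ⁅x, u⁆
    rw [LieSubmodule.coe_bracket] at this
    rw [LieHom.lie_apply, hc, this, lie_smul, sub_self, zero_smul]

end LieModule

variable [FiniteDimensional ℂ X]

section

attribute [local instance] LieRing.ofAssociativeRing

/-- A Lie algebra with a faithful finite-dimensional module whose trace form vanishes is
solvable. -/
theorem LieAlgebra.isSolvable_of_traceForm_eq_zero [FiniteDimensional ℂ L]
    (hinj : Function.Injective (LieModule.toEnd ℂ L X))
    (h : LieModule.traceForm ℂ L X = 0) : LieAlgebra.IsSolvable L := by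
  have hn := LieModule.isNilpotent_derivedSeries_of_traceForm_eq_zero h
  set D : LieIdeal ℂ L := LieAlgebra.derivedSeries ℂ L 1 with hD
  rw [LieModule.isNilpotent_iff_forall' (R := ℂ)] at hn
  let φ := LieModule.toEnd ℂ D X
  have hφ : Function.Injective φ := fun x y hxy ↦ Subtype.ext (hinj hxy)
  have hr : LieRing.IsNilpotent φ.range := by
    rw [LieAlgebra.isNilpotent_iff_forall (R := ℂ)]
    rintro ⟨-, ⟨y, rfl⟩⟩
    exact LieAlgebra.isNilpotent_ad_of_isNilpotent (hn y)
  have hDn : LieRing.IsNilpotent D :=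
    Function.Injective.lieAlgebra_isNilpotent (R := ℂ) (f := φ.rangeRestrict)
      (fun x y hxy ↦ hφ (congrArg Subtype.val hxy))
  obtain ⟨k, hk⟩ := LieAlgebra.IsSolvable.solvable ℂ D
  rw [LieIdeal.derivedSeries_eq_bot_iff] at hk
  refine LieAlgebra.IsSolvable.mk (R := ℂ) (k := k + 1) ?_
  rw [LieAlgebra.derivedSeries, LieAlgebra.derivedSeriesOfIdeal_add]
  exact hk

end

namespace LieModule

/-- On a completely reducible module, the center acts by semisimple endomorphisms. -/
theorem isSemisimple_toEnd_of_mem_center [ComplementedLattice (LieSubmodule ℂ L X)]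
    {z : L} (hz : ∀ x : L, ⁅x, z⁆ = 0) : (toEnd ℂ L X z).IsSemisimple := by
  obtain ⟨n, hn, s, -, hnil, hs, hsum⟩ :=
    (toEnd ℂ L X z).exists_isNilpotent_isSemisimple
  have hc (x : L) : Commute n (toEnd ℂ L X x) := by
    have hzx : Commute (toEnd ℂ L X x) (toEnd ℂ L X z) := by
      refine LinearMap.ext fun m ↦ ?_
      have := leibniz_lie x z m
      rw [hz, zero_lie, zero_add] at this
      simpa using this
    have hle : Algebra.adjoin ℂ {toEnd ℂ L X z} ≤
        Subalgebra.centralizer ℂ {toEnd ℂ L X x} := by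
      refine Algebra.adjoin_le ?_
      rintro _ rfl
      rw [SetLike.mem_coe, Subalgebra.mem_centralizer_iff]
      rintro _ rfl
      exact hzx.eq
    exact ((Subalgebra.mem_centralizer_iff ℂ).mp (hle hn) _ rfl).symm
  obtain ⟨C, hC⟩ := exists_isCompl (kerOfCommute n hc)
  suffices hn0 : n = 0 by rw [hsum, hn0, zero_add]; exact hs
  have hstab : ∀ v ∈ C, n v ∈ C := by
    refine Algebra.adjoin_induction (p := fun a _ ↦ ∀ v ∈ C, a v ∈ C) ?_ ?_ ?_ ?_ hn
    · rintro _ rfl v hv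
      exact C.lie_mem hv
    · intro r v hv
      exact C.smul_mem r hv
    · intro a a' _ _ ha ha' v hv
      exact C.add_mem (ha v hv) (ha' v hv)
    · intro a a' _ _ ha ha' v hv
      exact ha _ (ha' v hv)
  have hpow (j : ℕ) : ∀ v ∈ C, (n ^ j) v ∈ C := by
    induction j with
    | zero => exact fun v hv ↦ hv
    | succ j ih => exact fun v hv ↦ by rw [pow_succ']; exact hstab _ (ih v hv)
  have hzero (j : ℕ) : ∀ v ∈ C, (n ^ j) v = 0 → v = 0 := by
    induction j with
    | zero => exact fun v _ h ↦ h
    | succ j ih =>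
      intro v hv h
      rw [pow_succ', Module.End.mul_apply] at h
      have hb : (n ^ j) v ∈ kerOfCommute n hc ⊓ C := ⟨h, hpow j v hv⟩
      rw [hC.inf_eq_bot] at hb
      exact ih v hv hb
  obtain ⟨k, hk⟩ := hnil
  refine LinearMap.ext fun v ↦ ?_
  have hv : v ∈ kerOfCommute n hc ⊔ C := by rw [hC.sup_eq_top]; trivial
  obtain ⟨a, ha, w, hw, rfl⟩ := LieSubmodule.mem_sup _ _ _ |>.mp hv
  have hw0 : w = 0 := hzero k w hw (by rw [hk]; rfl)
  rw [hw0, add_zero]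
  exact ha

/-- An endomorphism commuting with `L` and killed by a functional `ρ` is nilpotent, as soon as
no proper submodule is detected by `ρ`. -/
theorem isNilpotent_of_minimal (ρ : X →ₗ[ℂ] ℂ) (hρ : ρ ≠ 0)
    (hmin : ∀ N : LieSubmodule ℂ L X, (∃ v ∈ N, ρ v ≠ 0) → N = ⊤)
    (c : Module.End ℂ X) (hc : ∀ x : L, Commute c (toEnd ℂ L X x))
    (hρc : ∀ v, ρ (c v) = 0) : _root_.IsNilpotent c := by
  obtain ⟨n, hn, h1⟩ :=
    (c.eventually_isCompl_ker_pow_range_pow.and (Filter.eventually_ge_atTop 1)).exists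
  refine ⟨n, ?_⟩
  have htop : kerOfCommute (c ^ n) (fun x ↦ (hc x).pow_left n) = ⊤ := by
    refine hmin _ ?_
    by_contra! hcon
    refine hρ (LinearMap.ext fun v ↦ ?_)
    have hv : v ∈ LinearMap.ker (c ^ n) ⊔ LinearMap.range (c ^ n) := by
      rw [hn.sup_eq_top]; trivial
    obtain ⟨a, ha, b, ⟨w, rfl⟩, rfl⟩ := Submodule.mem_sup.mp hv
    obtain ⟨m, rfl⟩ := Nat.exists_eq_add_of_le' h1
    rw [map_add, hcon a ha, pow_succ', Module.End.mul_apply, hρc]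
    simp
  refine LinearMap.ext fun v ↦ ?_
  have : v ∈ kerOfCommute (c ^ n) (fun x ↦ (hc x).pow_left n) := by rw [htop]; trivial
  exact this

/-- If the center of `L` acts trivially on a finite-dimensional module, then the trace form is
nondegenerate on any ideal complementing the kernel of the action. -/
theorem eq_zero_of_traceForm_eq_zero [FiniteDimensional ℂ L]
    [ComplementedLattice (LieIdeal ℂ L)]
    (hZ : ∀ z : L, (∀ x : L, ⁅x, z⁆ = 0) → ∀ m : X, ⁅z, m⁆ = 0)
    (D : LieIdeal ℂ L) (hD : IsCompl (LieModule.ker ℂ L X) D)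
    (x : L) (hx : x ∈ D) (h : ∀ y ∈ D, traceForm ℂ L X x y = 0) : x = 0 := by
  let J : LieIdeal ℂ L :=
    { carrier := {x | x ∈ D ∧ ∀ y ∈ D, traceForm ℂ L X x y = 0}
      add_mem' := fun {a b} ha hb ↦ ⟨D.add_mem ha.1 hb.1, fun y hy ↦ by
        rw [map_add, LinearMap.add_apply, ha.2 y hy, hb.2 y hy, add_zero]⟩
      zero_mem' := ⟨D.zero_mem, fun y _ ↦ by simp⟩
      smul_mem' := fun c a ha ↦ ⟨D.smul_mem c ha.1, fun y hy ↦ by simp [ha.2 y hy]⟩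
      lie_mem := fun {u a} ha ↦ ⟨D.lie_mem ha.1, fun y hy ↦ by
        rw [traceForm_apply_lie_apply', ha.2 _ (D.lie_mem hy), neg_zero]⟩ }
  have hJD : J ≤ D := fun a ha ↦ ha.1
  have hinj : Function.Injective (toEnd ℂ J X) := by
    intro a b hab
    have hk : (a - b : L) ∈ LieModule.ker ℂ L X ⊓ D := by
      refine ⟨?_, D.sub_mem (hJD a.2) (hJD b.2)⟩
      refine (LieModule.mem_ker ℂ L X _).mpr fun m ↦ ?_
      have := LinearMap.congr_fun hab m
      rw [sub_lie, sub_eq_zero]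
      exact this
    rw [hD.inf_eq_bot] at hk
    exact Subtype.ext (sub_eq_zero.mp hk)
  have hsolv : LieAlgebra.IsSolvable J := by
    refine LieAlgebra.isSolvable_of_traceForm_eq_zero hinj ?_
    ext a b
    exact a.2.2 b (hJD b.2)
  have hA := LieAlgebra.abelian_derivedAbelianOfIdeal J
  have hAJ : LieAlgebra.derivedAbelianOfIdeal J ≤ J := by
    unfold LieAlgebra.derivedAbelianOfIdeal
    split
    · exact bot_le
    · exact LieAlgebra.derivedSeriesOfIdeal_le_self J _
  set A := LieAlgebra.derivedAbelianOfIdeal J with hAdef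
  have hbot : A = ⊥ := by
    obtain ⟨C, hC⟩ := exists_isCompl A
    rw [LieSubmodule.eq_bot_iff]
    intro a ha
    have hcent (u : L) : ⁅u, a⁆ = 0 := by
      have hu : u ∈ A ⊔ C := by rw [hC.sup_eq_top]; trivial
      obtain ⟨p, hp, q, hq, rfl⟩ := LieSubmodule.mem_sup _ _ _ |>.mp hu
      have h1 : ⁅p, a⁆ = 0 := congrArg Subtype.val (hA.trivial ⟨p, hp⟩ ⟨a, ha⟩)
      have h2 : ⁅q, a⁆ ∈ A ⊓ C :=
        ⟨A.lie_mem ha, by rw [← lie_skew]; exact C.neg_mem (C.lie_mem hq)⟩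
      rw [hC.inf_eq_bot] at h2
      have h2' : ⁅q, a⁆ = 0 := h2
      rw [add_lie, h1, h2', add_zero]
    have hk : a ∈ LieModule.ker ℂ L X ⊓ D :=
      ⟨(LieModule.mem_ker ℂ L X _).mpr (hZ a hcent), hJD (hAJ ha)⟩
    rw [hD.inf_eq_bot] at hk
    exact hk
  rw [hAdef, LieAlgebra.abelian_of_solvable_ideal_eq_bot_iff] at hbot
  have hxJ : x ∈ J := ⟨hx, h⟩
  rw [hbot] at hxJ
  exact hxJ

/-- A module over a reductive Lie algebra whose center acts semisimply is trivial, if it has a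
nonzero invariant functional vanishing on all proper submodules. -/
theorem lie_eq_zero_of_minimal [FiniteDimensional ℂ L]
    [ComplementedLattice (LieIdeal ℂ L)]
    (hZ : ∀ z : L, (∀ x : L, ⁅x, z⁆ = 0) → (toEnd ℂ L X z).IsSemisimple)
    (ρ : X →ₗ[ℂ] ℂ) (hρ : ρ ≠ 0) (hinv : ∀ (x : L) (m : X), ρ ⁅x, m⁆ = 0)
    (hmin : ∀ N : LieSubmodule ℂ L X, (∃ v ∈ N, ρ v ≠ 0) → N = ⊤) (x : L) (m : X) :
    ⁅x, m⁆ = 0 := by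
  classical
  have hZ0 (z : L) (hz : ∀ x : L, ⁅x, z⁆ = 0) (m : X) : ⁅z, m⁆ = 0 := by
    have hnil : _root_.IsNilpotent (toEnd ℂ L X z) := by
      refine isNilpotent_of_minimal ρ hρ hmin _ (fun x ↦ ?_) (fun v ↦ hinv z v)
      refine LinearMap.ext fun m ↦ ?_
      have := leibniz_lie x z m
      rw [hz, zero_lie, zero_add] at this
      simpa using this.symm
    have := Module.End.eq_zero_of_isNilpotent_isSemisimple hnil (hZ z hz)
    exact LinearMap.congr_fun this m
  obtain ⟨D, hD⟩ := exists_isCompl (LieModule.ker ℂ L X)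
  let B : LinearMap.BilinForm ℂ D := (traceForm ℂ L X).restrict D.toSubmodule
  have hBsymm : B.IsSymm := ⟨fun a b ↦ traceForm_comm ℂ L X a b⟩
  have hB : B.Nondegenerate := by
    refine (hBsymm.isRefl.nondegenerate_iff_separatingLeft).mpr fun a ha ↦ ?_
    exact Subtype.ext (eq_zero_of_traceForm_eq_zero hZ0 D hD a a.2 fun y hy ↦ ha ⟨y, hy⟩)
  let b := Module.finBasis ℂ D
  let b' := B.dualBasis hB b
  let c : Module.End ℂ X := ∑ i, toEnd ℂ L X (b i) * toEnd ℂ L X (b' i)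
  have hc : ∀ x : L, Commute c (toEnd ℂ L X x) := by
    refine commute_casimir D b b' (fun v ↦ ?_) (fun v ↦ ?_)
    · conv_lhs => rw [← b.sum_repr v]
      refine Finset.sum_congr rfl fun i _ ↦ ?_
      congr 1
      have := LinearMap.BilinForm.dualBasis_repr_apply hB b' v i
      rw [LinearMap.BilinForm.dualBasis_dualBasis hB hBsymm] at this
      exact this
    · conv_lhs => rw [← b'.sum_repr v]
      refine Finset.sum_congr rfl fun i _ ↦ ?_
      congr 1
      rw [LinearMap.BilinForm.dualBasis_repr_apply hB b v i]
      exact traceForm_comm ℂ L X _ _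
  have hnil : _root_.IsNilpotent c := by
    refine isNilpotent_of_minimal ρ hρ hmin c hc fun v ↦ ?_
    simp [c, LinearMap.sum_apply, hinv]
  have htr : LinearMap.trace ℂ X c = (finrank ℂ D : ℂ) := by
    have hone (i) : LinearMap.trace ℂ X (toEnd ℂ L X (b i) * toEnd ℂ L X (b' i)) = 1 := by
      have := LinearMap.BilinForm.apply_dualBasis_right hB hBsymm b i i
      rw [if_pos rfl] at this
      exact this
    simp [c, hone]
  have hfin : finrank ℂ D = 0 := by
    have h0 := (LinearMap.isNilpotent_trace_of_isNilpotent hnil).eq_zero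
    rw [htr] at h0
    exact_mod_cast h0
  have hDbot : D = ⊥ := by
    have := Submodule.finrank_eq_zero.mp hfin
    exact (LieSubmodule.toSubmodule_eq_bot D).mp this
  have hx : x ∈ LieModule.ker ℂ L X := by
    have := hD.sup_eq_top
    rw [hDbot, sup_bot_eq] at this
    rw [this]; trivial
  exact (LieModule.mem_ker ℂ L X x).mp hx m

/-- A nonzero invariant functional on a module over a reductive Lie algebra whose center acts
semisimply takes the value one on some invariant vector. -/
theorem exists_invariant [FiniteDimensional ℂ L] [ComplementedLattice (LieIdeal ℂ L)]
    (hZ : ∀ z : L, (∀ x : L, ⁅x, z⁆ = 0) → (toEnd ℂ L X z).IsSemisimple)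
    (ρ : X →ₗ[ℂ] ℂ) (hρ : ρ ≠ 0) (hinv : ∀ (x : L) (m : X), ρ ⁅x, m⁆ = 0) :
    ∃ v : X, ρ v = 1 ∧ ∀ x : L, ⁅x, v⁆ = 0 := by
  have hwf : WellFoundedLT (LieSubmodule ℂ L X) :=
    LieSubmodule.wellFoundedLT_of_isArtinian ℂ L X
  obtain ⟨v₀, hv₀⟩ : ∃ v, ρ v ≠ 0 := by
    by_contra! h
    exact hρ (LinearMap.ext h)
  obtain ⟨N, ⟨v, hvN, hv⟩, hN⟩ := hwf.wf.has_min
    {N : LieSubmodule ℂ L X | ∃ v ∈ N, ρ v ≠ 0} ⟨⊤, v₀, trivial, hv₀⟩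
  have key : ∀ (x : L) (m : N), ⁅x, m⁆ = 0 := by
    refine lie_eq_zero_of_minimal (fun z hz ↦ isSemisimple_toEnd_submodule N (hZ z hz))
      (ρ ∘ₗ N.toSubmodule.subtype) (fun h ↦ hv ?_) (fun x m ↦ hinv x m) ?_
    · exact LinearMap.congr_fun h ⟨v, hvN⟩
    · rintro K ⟨w, hwK, hw⟩
      by_contra hK
      refine hN (K.map N.incl) ⟨w, (LieSubmodule.mem_map _).mpr ⟨w, hwK, rfl⟩, hw⟩ ?_
      refine lt_of_le_of_ne ?_ fun h ↦ hK ?_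
      · intro y hy
        obtain ⟨k, -, rfl⟩ := (LieSubmodule.mem_map _).mp hy
        exact k.2
      · rw [eq_top_iff]
        intro y _
        have hy : (y : X) ∈ K.map N.incl := by rw [h]; exact y.2
        obtain ⟨k, hk, hky⟩ := (LieSubmodule.mem_map _).mp hy
        rwa [← Subtype.ext hky]
  refine ⟨(ρ v)⁻¹ • v, by simp [hv], fun x ↦ ?_⟩
  have : ⁅x, v⁆ = 0 := congrArg Subtype.val (key x ⟨v, hvN⟩)
  rw [lie_smul, this, smul_zero]

section Hom

variable {Y : Type} [AddCommGroup Y] [Module ℂ Y] [LieRingModule L Y] [LieModule ℂ L Y]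
  [FiniteDimensional ℂ Y]

/-- An element acting semisimply on two modules acts semisimply on the linear maps between
them. -/
theorem isSemisimple_toEnd_hom {z : L} (hX : (toEnd ℂ L X z).IsSemisimple)
    (hY : (toEnd ℂ L Y z).IsSemisimple) : (toEnd ℂ L (X →ₗ[ℂ] Y) z).IsSemisimple := by
  let l : Module.End ℂ (X →ₗ[ℂ] Y) := LinearMap.llcomp ℂ X Y Y (toEnd ℂ L Y z)
  let r : Module.End ℂ (X →ₗ[ℂ] Y) := LinearMap.lcomp ℂ Y (toEnd ℂ L X z)
  have heq : toEnd ℂ L (X →ₗ[ℂ] Y) z = l - r := by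
    ext T m
    simp [l, r, LieHom.lie_apply]
  have hl (p : Polynomial ℂ) (T : X →ₗ[ℂ] Y) :
      Polynomial.aeval l p T = Polynomial.aeval (toEnd ℂ L Y z) p ∘ₗ T := by
    induction p using Polynomial.induction_on' with
    | add p q hp hq => rw [map_add, map_add, LinearMap.add_apply, hp, hq, LinearMap.add_comp]
    | monomial n a =>
      have hpow : (l ^ n) T = (toEnd ℂ L Y z ^ n) ∘ₗ T := by
        induction n with
        | zero => rfl
        | succ n ih => rw [pow_succ', pow_succ', Module.End.mul_apply, ih]; rfl
      ext m
      simp [Polynomial.aeval_monomial, hpow]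
  have hr (p : Polynomial ℂ) (T : X →ₗ[ℂ] Y) :
      Polynomial.aeval r p T = T ∘ₗ Polynomial.aeval (toEnd ℂ L X z) p := by
    induction p using Polynomial.induction_on' with
    | add p q hp hq => rw [map_add, map_add, LinearMap.add_apply, hp, hq, LinearMap.comp_add]
    | monomial n a =>
      have hpow : (r ^ n) T = T ∘ₗ (toEnd ℂ L X z ^ n) := by
        induction n with
        | zero => rfl
        | succ n ih => rw [pow_succ', pow_succ, Module.End.mul_apply, ih]; rfl
      ext m
      simp [Polynomial.aeval_monomial, hpow]
  rw [heq]
  refine Module.End.IsSemisimple.sub_of_commute (LinearMap.ext fun T ↦ rfl) ?_ ?_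
  · refine Module.End.isSemisimple_of_squarefree_aeval_eq_zero hY.minpoly_squarefree ?_
    refine LinearMap.ext fun T ↦ ?_
    rw [hl, minpoly.aeval, LinearMap.zero_comp, LinearMap.zero_apply]
  · refine Module.End.isSemisimple_of_squarefree_aeval_eq_zero hX.minpoly_squarefree ?_
    refine LinearMap.ext fun T ↦ ?_
    rw [hr, minpoly.aeval, LinearMap.comp_zero, LinearMap.zero_apply]

end Hom

/-- A finite-dimensional module over a reductive Lie algebra whose center acts semisimply is
completely reducible. -/
theorem complementedLattice_of_isSemisimple_center [FiniteDimensional ℂ L]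
    [ComplementedLattice (LieIdeal ℂ L)]
    (hZ : ∀ z : L, (∀ x : L, ⁅x, z⁆ = 0) → (toEnd ℂ L X z).IsSemisimple) :
    ComplementedLattice (LieSubmodule ℂ L X) := by
  refine ⟨fun U ↦ ?_⟩
  by_cases hU : U = ⊥
  · exact ⟨⊤, by rw [hU]; exact isCompl_bot_top⟩
  have hdim : (finrank ℂ U : ℂ) ≠ 0 := by
    intro h
    refine hU ((LieSubmodule.toSubmodule_eq_bot U).mp (Submodule.finrank_eq_zero.mp ?_))
    exact_mod_cast h
  let ρ : scalarOn U →ₗ[ℂ] ℂ := (finrank ℂ U : ℂ)⁻¹ • LinearMap.trace ℂ U ∘ₗ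
    LinearMap.lcomp ℂ U U.toSubmodule.subtype ∘ₗ (scalarOn U).toSubmodule.subtype
  have hρ (T : scalarOn U) (c : ℂ) (hc : ∀ u : U, T.1 u = c • u) : ρ T = c := by
    have : T.1 ∘ₗ U.toSubmodule.subtype = c • LinearMap.id := LinearMap.ext hc
    have h2 : ρ T = (finrank ℂ U : ℂ)⁻¹ * LinearMap.trace ℂ U (T.1 ∘ₗ U.toSubmodule.subtype) := rfl
    rw [h2, this, map_smul, LinearMap.trace_id, smul_eq_mul]
    exact (mul_comm _ _).trans (mul_inv_cancel_right₀ hdim c)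
  obtain ⟨q, hq⟩ := U.toSubmodule.exists_isCompl
  have hP (u : U) : U.toSubmodule.projectionOnto q hq u = (1 : ℂ) • u := by
    rw [one_smul]; exact Submodule.projectionOnto_apply_left hq u
  obtain ⟨⟨T, c, hc⟩, hT1, hT⟩ := exists_invariant (X := scalarOn U)
    (fun z hz ↦ isSemisimple_toEnd_submodule _ (isSemisimple_toEnd_hom (hZ z hz)
      (isSemisimple_toEnd_submodule U (hZ z hz)))) ρ
    (fun h ↦ by
      have h1 := hρ ⟨_, 1, hP⟩ 1 hP
      rw [h] at h1
      exact zero_ne_one h1)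
    (fun x ⟨T, c, hc⟩ ↦ hρ _ 0 fun u ↦ by
      have := hc ⁅x, u⁆
      rw [LieSubmodule.coe_bracket] at this
      rw [LieSubmodule.coe_bracket, LieHom.lie_apply, hc, this, lie_smul, sub_self, zero_smul])
  have hTu (u : U) : T u = u := by
    have := hρ ⟨T, c, hc⟩ c hc
    rw [hc, ← this, hT1, one_smul]
  let K : LieSubmodule ℂ L X :=
    { LinearMap.ker T with
      lie_mem := fun {x m} hm ↦ by
        have h1 : ⁅x, T⁆ m = 0 := LinearMap.congr_fun (congrArg Subtype.val (hT x)) m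
        have hm' : T m = 0 := hm
        rw [LieHom.lie_apply, hm', lie_zero, zero_sub, neg_eq_zero] at h1
        exact h1 }
  exact ⟨K, LieSubmodule.isCompl_toSubmodule.mp (LinearMap.isCompl_of_proj hTu)⟩

/-- Over a reductive Lie algebra, the linear maps between completely reducible modules form a
completely reducible module. -/
theorem complementedLattice_hom [FiniteDimensional ℂ L] [ComplementedLattice (LieIdeal ℂ L)]
    {Y : Type} [AddCommGroup Y] [Module ℂ Y] [LieRingModule L Y] [LieModule ℂ L Y]
    [FiniteDimensional ℂ Y] [ComplementedLattice (LieSubmodule ℂ L X)]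
    [ComplementedLattice (LieSubmodule ℂ L Y)] :
    ComplementedLattice (LieSubmodule ℂ L (X →ₗ[ℂ] Y)) :=
  complementedLattice_of_isSemisimple_center fun _ hz ↦ isSemisimple_toEnd_hom
    (isSemisimple_toEnd_of_mem_center hz) (isSemisimple_toEnd_of_mem_center hz)

end LieModule

end LieTheory

namespace LieSuperAlgebra

section EvenPart

variable (g : LieSuperAlgebra)

instance : LieRing (g.part 0) where
  bracket x y := ⟨g.bracket x y, by simpa using g.bracket_grading 0 0 x x.2 y y.2⟩
  add_lie x y z := Subtype.ext (by simp)
  lie_add x y z := Subtype.ext (by simp)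
  lie_self x := Subtype.ext <| by
    have h := g.bracket_skew 0 0 x x.2 x x.2
    simp only [ssgn, zero_ne_one, and_self, if_false, neg_smul, one_smul] at h
    have h2 : (2 : ℂ) • g.bracket x x = 0 := by
      rw [two_smul]
      exact add_eq_zero_iff_eq_neg.mpr h
    exact (smul_eq_zero.mp h2).resolve_left two_ne_zero
  leibniz_lie x y z := Subtype.ext <| by
    simpa [ssgn] using g.bracket_jacobi 0 0 0 x x.2 y y.2 z z.2

instance : LieAlgebra ℂ (g.part 0) where
  lie_smul c x y := Subtype.ext (by simp [Bracket.bracket])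

variable {g}

instance (M : g.SuperModule) : LieRingModule (g.part 0) M.carrier where
  bracket x m := M.act x m
  add_lie x y m := by simp
  lie_add x m n := by simp
  leibniz_lie x y m := by
    have h := M.act_bracket 0 0 x x.2 y y.2 m
    simp only [ssgn, zero_ne_one, and_self, if_false, one_smul] at h
    change M.act x (M.act y m) = M.act (g.bracket x y) m + M.act y (M.act x m)
    rw [h, sub_add_cancel]

instance (M : g.SuperModule) : LieModule ℂ (g.part 0) M.carrier where
  smul_lie c x m := by simp [Bracket.bracket]
  lie_smul c x m := by simp [Bracket.bracket]

theorem IsClassical.complementedLattice (hg : g.IsClassical) :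
    ComplementedLattice (LieIdeal ℂ (g.part 0)) := by
  refine ⟨fun U ↦ ?_⟩
  obtain ⟨U', hle, hst, hinf, hsup⟩ := hg.even_reducible (U.toSubmodule.map (g.part 0).subtype)
    (by rintro _ ⟨y, -, rfl⟩; exact y.2)
    (by rintro x hx _ ⟨y, hy, rfl⟩; exact ⟨⁅(⟨x, hx⟩ : g.part 0), y⁆, U.lie_mem hy, rfl⟩)
  let V : LieIdeal ℂ (g.part 0) :=
    { U'.comap (g.part 0).subtype with lie_mem := fun {x y} hy ↦ hst x x.2 y hy }
  refine ⟨V, LieSubmodule.isCompl_toSubmodule.mp ⟨?_, ?_⟩⟩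
  · rw [Submodule.disjoint_def]
    intro y hy hy'
    have : (y : g.carrier) ∈ U.toSubmodule.map (g.part 0).subtype ⊓ U' := ⟨⟨y, hy, rfl⟩, hy'⟩
    rw [hinf] at this
    exact Subtype.ext this
  · rw [codisjoint_iff, Submodule.eq_top_iff']
    intro y
    have : (y : g.carrier) ∈ U.toSubmodule.map (g.part 0).subtype ⊔ U' := by rw [hsup]; exact y.2
    obtain ⟨_, ⟨a, ha, rfl⟩, b, hb, hab⟩ := Submodule.mem_sup.mp this
    exact Submodule.mem_sup.mpr ⟨a, ha, ⟨b, hle hb⟩, hb, Subtype.ext hab⟩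

theorem SuperModule.IsCompletelyReducibleEven.complementedLattice {M : g.SuperModule}
    (hM : M.IsCompletelyReducibleEven) :
    ComplementedLattice (LieSubmodule ℂ (g.part 0) M.carrier) := by
  refine ⟨fun U ↦ ?_⟩
  obtain ⟨U', hst, hc⟩ := hM U.toSubmodule fun x hx m hm ↦ U.lie_mem (x := ⟨x, hx⟩) hm
  let V : LieSubmodule ℂ (g.part 0) M.carrier :=
    { U' with lie_mem := fun {x y} hy ↦ hst x x.2 y hy }
  exact ⟨V, LieSubmodule.isCompl_toSubmodule.mp hc⟩

/-- The linear maps between two objects of `F` are completely reducible under the commutator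
action of the even part. -/
theorem exists_isCompl_commutatorStable (hg : g.IsClassical) {M N : g.SuperModule}
    (hM : M.MemF) (hN : N.MemF) (U : Submodule ℂ (M.carrier →ₗ[ℂ] N.carrier))
    (hU : ∀ x ∈ g.part 0, ∀ T ∈ U, N.act x ∘ₗ T - T ∘ₗ M.act x ∈ U) :
    ∃ U' : Submodule ℂ (M.carrier →ₗ[ℂ] N.carrier),
      (∀ x ∈ g.part 0, ∀ T ∈ U', N.act x ∘ₗ T - T ∘ₗ M.act x ∈ U') ∧ IsCompl U U' := by
  have := hg.finiteDimensional
  have := hM.1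
  have := hN.1
  have := hg.complementedLattice
  have := hM.2.complementedLattice
  have := hN.2.complementedLattice
  have hc := LieModule.complementedLattice_hom (L := g.part 0) (X := M.carrier) (Y := N.carrier)
  let V : LieSubmodule ℂ (g.part 0) (M.carrier →ₗ[ℂ] N.carrier) :=
    { U with lie_mem := fun {x T} hT ↦ hU x x.2 T hT }
  obtain ⟨V', hV'⟩ := exists_isCompl V
  exact ⟨V'.toSubmodule, fun x hx T hT ↦ V'.lie_mem (x := ⟨x, hx⟩) hT,
    LieSubmodule.isCompl_toSubmodule.mpr hV'⟩

end EvenPart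

end LieSuperAlgebra

namespace SuperVS

variable (W : SuperVS)

theorem projEven_of_mem_zero {m : W.carrier} (hm : m ∈ W.part 0) : W.projEven m = m :=
  congrArg Subtype.val (Submodule.projectionOnto_apply_left W.isCompl ⟨m, hm⟩)

theorem projOdd_of_mem_zero {m : W.carrier} (hm : m ∈ W.part 0) : W.projOdd m = 0 :=
  congrArg Subtype.val (Submodule.projectionOnto_apply_of_mem_right W.isCompl.symm hm)

theorem projEven_of_mem_one {m : W.carrier} (hm : m ∈ W.part 1) : W.projEven m = 0 :=
  congrArg Subtype.val (Submodule.projectionOnto_apply_of_mem_right W.isCompl hm)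

theorem projOdd_of_mem_one {m : W.carrier} (hm : m ∈ W.part 1) : W.projOdd m = m :=
  congrArg Subtype.val (Submodule.projectionOnto_apply_left W.isCompl.symm ⟨m, hm⟩)

theorem pty_of_mem_zero {m : W.carrier} (hm : m ∈ W.part 0) : W.pty m = m := by
  rw [pty, LinearMap.sub_apply, W.projEven_of_mem_zero hm, W.projOdd_of_mem_zero hm, sub_zero]

theorem pty_of_mem_one {m : W.carrier} (hm : m ∈ W.part 1) : W.pty m = -m := by
  rw [pty, LinearMap.sub_apply, W.projEven_of_mem_one hm, W.projOdd_of_mem_one hm, zero_sub]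

theorem exists_add (m : W.carrier) : ∃ a ∈ W.part 0, ∃ b ∈ W.part 1, a + b = m :=
  Submodule.mem_sup.mp (by rw [W.isCompl.sup_eq_top]; trivial)

@[simp]
theorem pty_pty (m : W.carrier) : W.pty (W.pty m) = m := by
  obtain ⟨a, ha, b, hb, rfl⟩ := W.exists_add m
  simp [W.pty_of_mem_zero ha, W.pty_of_mem_one hb]

/-- The automorphism acting as `1` on the even part and as `I` on the odd part, a square root
of the parity involution. -/
def sqrtPty : W.carrier ≃ₗ[ℂ] W.carrier :=
  LinearEquiv.ofLinearMap
    (((1 + Complex.I) / 2) • LinearMap.id + ((1 - Complex.I) / 2) • W.pty)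
    (((1 - Complex.I) / 2) • LinearMap.id + ((1 + Complex.I) / 2) • W.pty)
    (by
      ext m
      simp only [LinearMap.comp_apply, LinearMap.add_apply, LinearMap.smul_apply,
        LinearMap.id_apply, map_add, map_smul, pty_pty]
      match_scalars <;> ring_nf <;> simp only [Complex.I_sq] <;> norm_num)
    (by
      ext m
      simp only [LinearMap.comp_apply, LinearMap.add_apply, LinearMap.smul_apply,
        LinearMap.id_apply, map_add, map_smul, pty_pty]
      match_scalars <;> ring_nf <;> simp only [Complex.I_sq] <;> norm_num)

theorem sqrtPty_apply (m : W.carrier) : W.sqrtPty m =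
    ((1 + Complex.I) / 2) • m + ((1 - Complex.I) / 2) • W.pty m := rfl

theorem sqrtPty_symm_apply (m : W.carrier) : W.sqrtPty.symm m =
    ((1 - Complex.I) / 2) • m + ((1 + Complex.I) / 2) • W.pty m := rfl

theorem pty_sqrtPty (m : W.carrier) : W.pty (W.sqrtPty m) = W.sqrtPty.symm m := by
  rw [sqrtPty_apply, sqrtPty_symm_apply, map_add, map_smul, map_smul, pty_pty, add_comm]

theorem pty_sqrtPty_symm (m : W.carrier) : W.pty (W.sqrtPty.symm m) = W.sqrtPty m := by
  rw [sqrtPty_apply, sqrtPty_symm_apply, map_add, map_smul, map_smul, pty_pty, add_comm]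

theorem sqrtPty_pty (m : W.carrier) : W.sqrtPty (W.pty m) = W.sqrtPty.symm m := by
  rw [sqrtPty_apply, sqrtPty_symm_apply, pty_pty, add_comm]

theorem sqrtPty_symm_pty (m : W.carrier) : W.sqrtPty.symm (W.pty m) = W.sqrtPty m := by
  rw [sqrtPty_apply, sqrtPty_symm_apply, pty_pty, add_comm]

/-- The super vector space whose parity involution is a given involution. -/
abbrev ofInvolution (V : Type) [AddCommGroup V] [Module ℂ V] (s : V →ₗ[ℂ] V)
    (hs : ∀ v, s (s v) = v) : SuperVS where
  carrier := V
  part i := LinearMap.ker (s - ssgn i 1 • LinearMap.id)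
  isCompl := by
    have h0 (v : V) : v ∈ LinearMap.ker (s - ssgn 0 1 • LinearMap.id) ↔ s v = v := by
      simp [ssgn, sub_eq_zero]
    have h1 (v : V) : v ∈ LinearMap.ker (s - ssgn 1 1 • LinearMap.id) ↔ s v = -v := by
      simp [ssgn, add_eq_zero_iff_eq_neg]
    constructor
    · rw [Submodule.disjoint_def]
      intro v hv hv'
      rw [h0] at hv
      rw [h1, hv] at hv'
      have h2 : (2 : ℂ) • v = 0 := by
        rw [two_smul]
        exact add_eq_zero_iff_eq_neg.mpr hv'
      exact (smul_eq_zero.mp h2).resolve_left two_ne_zero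
    · rw [codisjoint_iff, Submodule.eq_top_iff']
      intro v
      refine Submodule.mem_sup.mpr ⟨(1 / 2 : ℂ) • (v + s v), ?_, (1 / 2 : ℂ) • (v - s v), ?_, ?_⟩
      · rw [h0, map_smul, map_add, hs, add_comm]
      · rw [h1, map_smul, map_sub, hs, ← smul_neg, neg_sub]
      · module

theorem mem_ofInvolution {V : Type} [AddCommGroup V] [Module ℂ V] {s : V →ₗ[ℂ] V}
    {hs : ∀ v, s (s v) = v} {i : ZMod 2} {v : V} :
    v ∈ (ofInvolution V s hs).part i ↔ s v = ssgn i 1 • v := by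
  simp [sub_eq_zero]

end SuperVS

namespace LieSuperAlgebra

variable {g : LieSuperAlgebra}

namespace SuperModule

theorem act_pty_of_even (M : g.SuperModule) {x : g.carrier} (hx : x ∈ g.part 0)
    (m : M.carrier) : M.act x (M.pty m) = M.pty (M.act x m) := by
  obtain ⟨a, ha, b, hb, rfl⟩ := M.exists_add m
  have h0 : M.act x a ∈ M.part 0 := by simpa using M.act_grading 0 0 x hx a ha
  have h1 : M.act x b ∈ M.part 1 := by simpa using M.act_grading 0 1 x hx b hb
  simp [M.pty_of_mem_zero ha, M.pty_of_mem_one hb, M.pty_of_mem_zero h0, M.pty_of_mem_one h1]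

theorem act_pty_of_odd (M : g.SuperModule) {x : g.carrier} (hx : x ∈ g.part 1)
    (m : M.carrier) : M.act x (M.pty m) = -M.pty (M.act x m) := by
  obtain ⟨a, ha, b, hb, rfl⟩ := M.exists_add m
  have h0 : M.act x a ∈ M.part 1 := by simpa using M.act_grading 1 0 x hx a ha
  have h1 : M.act x b ∈ M.part 0 := M.act_grading 1 1 x hx b hb
  simp [M.pty_of_mem_zero ha, M.pty_of_mem_one hb, M.pty_of_mem_one h0, M.pty_of_mem_zero h1]
  abel

theorem sqrtPty_act_of_even (M : g.SuperModule) {x : g.carrier} (hx : x ∈ g.part 0)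
    (m : M.carrier) : M.sqrtPty (M.act x m) = M.act x (M.sqrtPty m) := by
  simp [SuperVS.sqrtPty_apply, M.act_pty_of_even hx]

theorem sqrtPty_symm_act_of_even (M : g.SuperModule) {x : g.carrier} (hx : x ∈ g.part 0)
    (m : M.carrier) : M.sqrtPty.symm (M.act x m) = M.act x (M.sqrtPty.symm m) := by
  simp [SuperVS.sqrtPty_symm_apply, M.act_pty_of_even hx]

theorem sqrtPty_act_of_odd (M : g.SuperModule) {x : g.carrier} (hx : x ∈ g.part 1)
    (m : M.carrier) :
    M.sqrtPty (M.act x m) = Complex.I • M.act x (M.sqrtPty.symm m) := by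
  rw [SuperVS.sqrtPty_apply, SuperVS.sqrtPty_symm_apply, map_add, map_smul, map_smul,
    M.act_pty_of_odd hx]
  match_scalars <;> ring_nf <;> simp only [Complex.I_sq] <;> ring

theorem sqrtPty_symm_act_of_odd (M : g.SuperModule) {x : g.carrier} (hx : x ∈ g.part 1)
    (m : M.carrier) :
    M.sqrtPty.symm (M.act x m) = -Complex.I • M.act x (M.sqrtPty m) := by
  rw [SuperVS.sqrtPty_apply, SuperVS.sqrtPty_symm_apply, map_add, map_smul, map_smul,
    M.act_pty_of_odd hx]
  match_scalars <;> ring_nf <;> simp only [Complex.I_sq] <;> ring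

end SuperModule

/-- A linear map commuting with the action of `g`, without any signs. -/
def IsEquivariant (M N : g.SuperModule) (f : M.carrier →ₗ[ℂ] N.carrier) : Prop :=
  ∀ x m, f (M.act x m) = N.act x (f m)

theorem isEquivariant_of_homogeneous {M N : g.SuperModule} {f : M.carrier →ₗ[ℂ] N.carrier}
    (h0 : ∀ x ∈ g.part 0, ∀ m, f (M.act x m) = N.act x (f m))
    (h1 : ∀ x ∈ g.part 1, ∀ m, f (M.act x m) = N.act x (f m)) : IsEquivariant M N f := by
  intro x m
  obtain ⟨a, ha, b, hb, rfl⟩ := g.exists_add x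
  simp [h0 a ha, h1 b hb]

/-- Conjugation by the square root of the parity turns a homomorphism of supermodules into an
equivariant map. -/
theorem SuperHom.isEquivariant {M N : g.SuperModule} (f : g.SuperHom M N) :
    IsEquivariant M N (N.sqrtPty ∘ₗ f.toLinearMap ∘ₗ M.sqrtPty.symm) := by
  refine isEquivariant_of_homogeneous (fun x hx m ↦ ?_) (fun x hx m ↦ ?_)
  · have h := f.compat 0 x hx (M.sqrtPty.symm m)
    simp only [SuperVS.ptyPow, if_true, LinearMap.id_apply] at h
    simp only [LinearMap.comp_apply, LinearEquiv.coe_coe]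
    rw [M.sqrtPty_symm_act_of_even hx, h, N.sqrtPty_act_of_even hx]
  · have h := f.compat 1 x hx (M.sqrtPty m)
    simp only [SuperVS.ptyPow, one_ne_zero, if_false] at h
    simp only [LinearMap.comp_apply, LinearEquiv.coe_coe]
    rw [M.sqrtPty_symm_act_of_odd hx, map_smul, h, map_smul, N.sqrtPty_act_of_odd hx,
      SuperVS.sqrtPty_symm_pty, SuperVS.pty_sqrtPty, smul_smul]
    simp

/-- The homomorphism of supermodules attached to an equivariant map. -/
def SuperHom.ofIsEquivariant {M N : g.SuperModule} {f : M.carrier →ₗ[ℂ] N.carrier}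
    (hf : IsEquivariant M N f) : g.SuperHom M N where
  toLinearMap := N.sqrtPty.symm ∘ₗ f ∘ₗ M.sqrtPty
  compat i x hx m := by
    simp only [LinearMap.comp_apply, LinearEquiv.coe_coe]
    obtain rfl | rfl : i = 0 ∨ i = 1 := (by decide : ∀ i : ZMod 2, i = 0 ∨ i = 1) i
    · simp only [SuperVS.ptyPow, if_true, LinearMap.id_apply]
      rw [M.sqrtPty_act_of_even hx, hf, N.sqrtPty_symm_act_of_even hx]
    · simp only [SuperVS.ptyPow, one_ne_zero, if_false]
      rw [M.sqrtPty_act_of_odd hx, map_smul, hf, map_smul, N.sqrtPty_symm_act_of_odd hx,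
        SuperVS.sqrtPty_pty, SuperVS.pty_sqrtPty_symm, smul_smul]
      simp

/-- Projectivity in `F`, tested on equivariant maps. -/
theorem isProjectiveInF_iff {P : g.SuperModule} (hP : P.MemF) : g.IsProjectiveInF P ↔
    ∀ A B : g.SuperModule, A.MemF → B.MemF → ∀ p : A.carrier →ₗ[ℂ] B.carrier,
      IsEquivariant A B p → Function.Surjective p → ∀ f : P.carrier →ₗ[ℂ] B.carrier,
        IsEquivariant P B f →
          ∃ h : P.carrier →ₗ[ℂ] A.carrier, IsEquivariant P A h ∧ p ∘ₗ h = f := by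
  refine ⟨fun H A B hA hB p hp hsurj f hf ↦ ?_, fun H ↦ ⟨hP, fun A B hA hB p hsurj f ↦ ?_⟩⟩
  · obtain ⟨h, hh⟩ := H.2 A B hA hB (.ofIsEquivariant hp)
      (B.sqrtPty.symm.surjective.comp (hsurj.comp A.sqrtPty.surjective)) (.ofIsEquivariant hf)
    refine ⟨_, h.isEquivariant, LinearMap.ext fun m ↦ ?_⟩
    have := LinearMap.congr_fun hh (P.sqrtPty.symm m)
    simpa [SuperHom.ofIsEquivariant] using this
  · obtain ⟨h, hh, hph⟩ := H A B hA hB _ p.isEquivariant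
      (B.sqrtPty.surjective.comp (hsurj.comp A.sqrtPty.symm.surjective)) _ f.isEquivariant
    refine ⟨.ofIsEquivariant hh, LinearMap.ext fun m ↦ ?_⟩
    have := LinearMap.congr_fun hph (P.sqrtPty m)
    simpa [SuperHom.ofIsEquivariant] using this

/-- Injectivity in `F`, tested on equivariant maps. -/
theorem isInjectiveInF_iff {Q : g.SuperModule} (hQ : Q.MemF) : g.IsInjectiveInF Q ↔
    ∀ A B : g.SuperModule, A.MemF → B.MemF → ∀ ι : A.carrier →ₗ[ℂ] B.carrier,
      IsEquivariant A B ι → Function.Injective ι → ∀ f : A.carrier →ₗ[ℂ] Q.carrier,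
        IsEquivariant A Q f →
          ∃ h : B.carrier →ₗ[ℂ] Q.carrier, IsEquivariant B Q h ∧ h ∘ₗ ι = f := by
  refine ⟨fun H A B hA hB ι hι hinj f hf ↦ ?_, fun H ↦ ⟨hQ, fun A B hA hB ι hinj f ↦ ?_⟩⟩
  · obtain ⟨h, hh⟩ := H.2 A B hA hB (.ofIsEquivariant hι)
      (B.sqrtPty.symm.injective.comp (hinj.comp A.sqrtPty.injective)) (.ofIsEquivariant hf)
    refine ⟨_, h.isEquivariant, LinearMap.ext fun m ↦ ?_⟩
    have := LinearMap.congr_fun hh (A.sqrtPty.symm m)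
    simp only [SuperHom.ofIsEquivariant, LinearMap.comp_apply, LinearEquiv.coe_coe,
      LinearEquiv.apply_symm_apply] at this
    simp [this]
  · obtain ⟨h, hh, hph⟩ := H A B hA hB _ ι.isEquivariant
      (B.sqrtPty.injective.comp (hinj.comp A.sqrtPty.symm.injective)) _ f.isEquivariant
    refine ⟨.ofIsEquivariant hh, LinearMap.ext fun m ↦ ?_⟩
    have := LinearMap.congr_fun hph (A.sqrtPty m)
    simp only [LinearMap.comp_apply, LinearEquiv.coe_coe, LinearEquiv.symm_apply_apply] at this
    simp [SuperHom.ofIsEquivariant, this]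

end LieSuperAlgebra

namespace LieSuperAlgebra

variable {g : LieSuperAlgebra}

namespace SuperModule

/-- A supermodule presented by its parity involution and by the actions `e`, `o` of the even
and of the odd part of `g`. -/
abbrev ofInvolution (V : Type) [AddCommGroup V] [Module ℂ V] (s : V →ₗ[ℂ] V)
    (hs : ∀ v, s (s v) = v) (e o : g.carrier →ₗ[ℂ] V →ₗ[ℂ] V)
    (hse : ∀ x ∈ g.part 0, ∀ v, s (e x v) = e x (s v))
    (hso : ∀ x ∈ g.part 1, ∀ v, s (o x v) = -o x (s v))
    (hee : ∀ x ∈ g.part 0, ∀ y ∈ g.part 0, ∀ v,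
      e (g.bracket x y) v = e x (e y v) - e y (e x v))
    (heo : ∀ x ∈ g.part 0, ∀ y ∈ g.part 1, ∀ v,
      o (g.bracket x y) v = e x (o y v) - o y (e x v))
    (hoo : ∀ x ∈ g.part 1, ∀ y ∈ g.part 1, ∀ v,
      e (g.bracket x y) v = o x (o y v) + o y (o x v)) : g.SuperModule where
  toSuperVS := SuperVS.ofInvolution V s hs
  act := e ∘ₗ g.projEven + o ∘ₗ g.projOdd
  act_grading i j x hx m hm := by
    rw [SuperVS.mem_ofInvolution] at hm ⊢
    obtain rfl | rfl := (by decide : ∀ i : ZMod 2, i = 0 ∨ i = 1) i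
    · simp only [LinearMap.add_apply, LinearMap.comp_apply, g.projEven_of_mem_zero hx,
        g.projOdd_of_mem_zero hx, map_zero, add_zero, zero_add]
      rw [hse x hx, hm, map_smul]
    · simp only [LinearMap.add_apply, LinearMap.comp_apply, g.projEven_of_mem_one hx,
        g.projOdd_of_mem_one hx, map_zero, zero_add]
      rw [hso x hx, hm, map_smul, ← neg_smul]
      congr 1
      obtain rfl | rfl := (by decide : ∀ i : ZMod 2, i = 0 ∨ i = 1) j
      · simp [ssgn]
      · simp [ssgn, (by decide : (1 + 1 : ZMod 2) = 0)]
  act_bracket i j x hx y hy m := by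
    have hxy := g.bracket_grading i j x hx y hy
    obtain rfl | rfl := (by decide : ∀ i : ZMod 2, i = 0 ∨ i = 1) i <;>
      obtain rfl | rfl := (by decide : ∀ i : ZMod 2, i = 0 ∨ i = 1) j
    · rw [add_zero] at hxy
      simp [g.projEven_of_mem_zero hx, g.projOdd_of_mem_zero hx, g.projEven_of_mem_zero hy,
        g.projOdd_of_mem_zero hy, g.projEven_of_mem_zero hxy, g.projOdd_of_mem_zero hxy, ssgn,
        hee x hx y hy]
    · rw [zero_add] at hxy
      simp [g.projEven_of_mem_zero hx, g.projOdd_of_mem_zero hx, g.projEven_of_mem_one hy,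
        g.projOdd_of_mem_one hy, g.projEven_of_mem_one hxy, g.projOdd_of_mem_one hxy, ssgn,
        heo x hx y hy]
    · rw [add_zero] at hxy
      have hskew : o (g.bracket x y) m = -o (g.bracket y x) m := by
        rw [g.bracket_skew 1 0 x hx y hy]
        simp [ssgn]
      simp [g.projEven_of_mem_one hx, g.projOdd_of_mem_one hx, g.projEven_of_mem_zero hy,
        g.projOdd_of_mem_zero hy, g.projEven_of_mem_one hxy, g.projOdd_of_mem_one hxy, ssgn,
        hskew, heo y hy x hx]
    · rw [(by decide : (1 + 1 : ZMod 2) = 0)] at hxy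
      simp [g.projEven_of_mem_one hx, g.projOdd_of_mem_one hx, g.projEven_of_mem_one hy,
        g.projOdd_of_mem_one hy, g.projEven_of_mem_zero hxy, g.projOdd_of_mem_zero hxy, ssgn,
        hoo x hx y hy]

theorem act_bracket_even_even (M : g.SuperModule) {x y : g.carrier} (hx : x ∈ g.part 0)
    (hy : y ∈ g.part 0) (m : M.carrier) :
    M.act (g.bracket x y) m = M.act x (M.act y m) - M.act y (M.act x m) := by
  simpa [ssgn] using M.act_bracket 0 0 x hx y hy m

theorem act_bracket_even_odd (M : g.SuperModule) {x y : g.carrier} (hx : x ∈ g.part 0)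
    (hy : y ∈ g.part 1) (m : M.carrier) :
    M.act (g.bracket x y) m = M.act x (M.act y m) - M.act y (M.act x m) := by
  simpa [ssgn] using M.act_bracket 0 1 x hx y hy m

theorem act_bracket_odd_odd (M : g.SuperModule) {x y : g.carrier} (hx : x ∈ g.part 1)
    (hy : y ∈ g.part 1) (m : M.carrier) :
    M.act (g.bracket x y) m = M.act x (M.act y m) + M.act y (M.act x m) := by
  simpa [ssgn] using M.act_bracket 1 1 x hx y hy m

variable (M N : g.SuperModule)

/-- The parity involution on linear maps. -/
def homPty : (M.carrier →ₗ[ℂ] N.carrier) →ₗ[ℂ] (M.carrier →ₗ[ℂ] N.carrier) :=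
  LinearMap.llcomp ℂ _ _ _ N.pty ∘ₗ LinearMap.lcomp ℂ _ M.pty

@[simp]
theorem homPty_apply (T : M.carrier →ₗ[ℂ] N.carrier) (m : M.carrier) :
    M.homPty N T m = N.pty (T (M.pty m)) := rfl

/-- The commutator action on linear maps. -/
def homComm : g.carrier →ₗ[ℂ] (M.carrier →ₗ[ℂ] N.carrier) →ₗ[ℂ] (M.carrier →ₗ[ℂ] N.carrier) :=
  LinearMap.mk₂ ℂ (fun x T ↦ N.act x ∘ₗ T - T ∘ₗ M.act x)
    (fun x y T ↦ by ext m; simp; abel) (fun c x T ↦ by ext m; simp [smul_sub])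
    (fun x S T ↦ by ext m; simp; abel) (fun c x T ↦ by ext m; simp [smul_sub])

@[simp]
theorem homComm_apply (x : g.carrier) (T : M.carrier →ₗ[ℂ] N.carrier) (m : M.carrier) :
    M.homComm N x T m = N.act x (T m) - T (M.act x m) := rfl

/-- The action of odd elements used in `homPost`. -/
def homPostOdd :
    g.carrier →ₗ[ℂ] (M.carrier →ₗ[ℂ] N.carrier) →ₗ[ℂ] (M.carrier →ₗ[ℂ] N.carrier) :=
  LinearMap.mk₂ ℂ (fun x T ↦ (N.act x ∘ₗ T - T ∘ₗ M.act x) ∘ₗ M.pty)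
    (fun x y T ↦ by ext m; simp; abel) (fun c x T ↦ by ext m; simp [smul_sub])
    (fun x S T ↦ by ext m; simp; abel) (fun c x T ↦ by ext m; simp [smul_sub])

@[simp]
theorem homPostOdd_apply (x : g.carrier) (T : M.carrier →ₗ[ℂ] N.carrier) (m : M.carrier) :
    M.homPostOdd N x T m = N.act x (T (M.pty m)) - T (M.act x (M.pty m)) := rfl

/-- The action of odd elements used in `homPre`. -/
def homPreOdd :
    g.carrier →ₗ[ℂ] (M.carrier →ₗ[ℂ] N.carrier) →ₗ[ℂ] (M.carrier →ₗ[ℂ] N.carrier) :=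
  LinearMap.mk₂ ℂ (fun x T ↦ N.act x ∘ₗ T + Complex.I • N.pty ∘ₗ T ∘ₗ M.act x)
    (fun x y T ↦ by ext m; simp; abel)
    (fun c x T ↦ by ext m; simp [smul_comm c Complex.I])
    (fun x S T ↦ by ext m; simp; abel)
    (fun c x T ↦ by ext m; simp [smul_comm c Complex.I])

@[simp]
theorem homPreOdd_apply (x : g.carrier) (T : M.carrier →ₗ[ℂ] N.carrier) (m : M.carrier) :
    M.homPreOdd N x T m = N.act x (T m) + Complex.I • N.pty (T (M.act x m)) := rfl

/-- The supermodule of linear maps `M → N`, with signs normalized so that post-composition with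
an equivariant map is equivariant. -/
abbrev homPost : g.SuperModule :=
  ofInvolution (M.carrier →ₗ[ℂ] N.carrier) (M.homPty N) (fun T ↦ by ext; simp)
    (M.homComm N) (M.homPostOdd N)
    (fun x hx T ↦ by ext; simp [act_pty_of_even _ hx])
    (fun x hx T ↦ by ext; simp [act_pty_of_odd _ hx]; abel)
    (fun x hx y hy T ↦ by ext; simp [act_bracket_even_even _ hx hy]; abel)
    (fun x hx y hy T ↦ by
      ext; simp [act_bracket_even_odd _ hx hy, act_pty_of_even _ hx, act_pty_of_odd _ hy]; abel)
    (fun x hx y hy T ↦ by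
      ext; simp [act_bracket_odd_odd _ hx hy, act_pty_of_odd _ hx, act_pty_of_odd _ hy]; abel)

/-- The supermodule of linear maps `M → N`, with signs normalized so that pre-composition with
an equivariant map is equivariant. -/
abbrev homPre : g.SuperModule :=
  ofInvolution (M.carrier →ₗ[ℂ] N.carrier) (M.homPty N) (fun T ↦ by ext; simp)
    (M.homComm N) (M.homPreOdd N)
    (fun x hx T ↦ by ext; simp [act_pty_of_even _ hx])
    (fun x hx T ↦ by ext; simp [act_pty_of_odd _ hx]; abel)
    (fun x hx y hy T ↦ by ext; simp [act_bracket_even_even _ hx hy]; abel)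
    (fun x hx y hy T ↦ by
      ext; simp [act_bracket_even_odd _ hx hy, act_pty_of_even _ hx, smul_sub]; abel)
    (fun x hx y hy T ↦ by
      ext; simp [act_bracket_odd_odd _ hx hy, act_pty_of_odd _ hx, act_pty_of_odd _ hy,
        smul_smul]; abel)

variable {M N}

theorem homPost_act_of_even {x : g.carrier} (hx : x ∈ g.part 0) (T : M.carrier →ₗ[ℂ] N.carrier) :
    (M.homPost N).act x T = M.homComm N x T := by
  simp [g.projEven_of_mem_zero hx, g.projOdd_of_mem_zero hx]

theorem homPost_act_of_odd {x : g.carrier} (hx : x ∈ g.part 1) (T : M.carrier →ₗ[ℂ] N.carrier) :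
    (M.homPost N).act x T = M.homPostOdd N x T := by
  simp [g.projEven_of_mem_one hx, g.projOdd_of_mem_one hx]

theorem homPre_act_of_even {x : g.carrier} (hx : x ∈ g.part 0) (T : M.carrier →ₗ[ℂ] N.carrier) :
    (M.homPre N).act x T = M.homComm N x T := by
  simp [g.projEven_of_mem_zero hx, g.projOdd_of_mem_zero hx]

theorem homPre_act_of_odd {x : g.carrier} (hx : x ∈ g.part 1) (T : M.carrier →ₗ[ℂ] N.carrier) :
    (M.homPre N).act x T = M.homPreOdd N x T := by
  simp [g.projEven_of_mem_one hx, g.projOdd_of_mem_one hx]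

theorem MemF.homPost (hg : g.IsClassical) (hM : M.MemF) (hN : N.MemF) : (M.homPost N).MemF := by
  have := hM.1
  have := hN.1
  refine ⟨inferInstanceAs (FiniteDimensional ℂ (M.carrier →ₗ[ℂ] N.carrier)), fun U hU ↦ ?_⟩
  obtain ⟨U', hU', hc⟩ := exists_isCompl_commutatorStable hg hM hN U fun x hx T hT ↦ by
    have := hU x hx T hT
    rwa [homPost_act_of_even hx] at this
  exact ⟨U', fun x hx T hT ↦ by rw [homPost_act_of_even hx]; exact hU' x hx T hT, hc⟩

theorem MemF.homPre (hg : g.IsClassical) (hM : M.MemF) (hN : N.MemF) : (M.homPre N).MemF := by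
  have := hM.1
  have := hN.1
  refine ⟨inferInstanceAs (FiniteDimensional ℂ (M.carrier →ₗ[ℂ] N.carrier)), fun U hU ↦ ?_⟩
  obtain ⟨U', hU', hc⟩ := exists_isCompl_commutatorStable hg hM hN U fun x hx T hT ↦ by
    have := hU x hx T hT
    rwa [homPre_act_of_even hx] at this
  exact ⟨U', fun x hx T hT ↦ by rw [homPre_act_of_even hx]; exact hU' x hx T hT, hc⟩

end SuperModule

end LieSuperAlgebra

namespace LieSuperAlgebra

variable {g : LieSuperAlgebra}

open SuperModule

/-- Restriction along post-composition with an equivariant map is equivariant. -/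
theorem isEquivariant_homPre_homPost {P Q A B : g.SuperModule} {ι : A.carrier →ₗ[ℂ] B.carrier}
    (hι : IsEquivariant A B ι) :
    IsEquivariant ((P.homPost B).homPre Q) ((P.homPost A).homPre Q)
      (LinearMap.lcomp ℂ Q.carrier (LinearMap.llcomp ℂ P.carrier _ _ ι)) := by
  refine isEquivariant_of_homogeneous (fun x hx S ↦ ?_) (fun x hx S ↦ ?_)
  · rw [homPre_act_of_even hx, homPre_act_of_even hx]
    refine LinearMap.ext fun T ↦ ?_
    have h : ι ∘ₗ (P.homPost A).act x T = (P.homPost B).act x (ι ∘ₗ T) := by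
      rw [homPost_act_of_even hx, homPost_act_of_even hx]
      refine LinearMap.ext fun m ↦ ?_
      simp [hι x]
    have h' := congrArg S h
    change Q.act x (S (ι ∘ₗ T)) - S ((P.homPost B).act x (ι ∘ₗ T)) =
      Q.act x (S (ι ∘ₗ T)) - S (ι ∘ₗ (P.homPost A).act x T)
    rw [h']
  · rw [homPre_act_of_odd hx, homPre_act_of_odd hx]
    refine LinearMap.ext fun T ↦ ?_
    have h : ι ∘ₗ (P.homPost A).act x T = (P.homPost B).act x (ι ∘ₗ T) := by
      rw [homPost_act_of_odd hx, homPost_act_of_odd hx]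
      refine LinearMap.ext fun m ↦ ?_
      simp [hι x]
    have h' := congrArg S h
    change Q.act x (S (ι ∘ₗ T)) + Complex.I • Q.pty (S ((P.homPost B).act x (ι ∘ₗ T))) =
      Q.act x (S (ι ∘ₗ T)) + Complex.I • Q.pty (S (ι ∘ₗ (P.homPost A).act x T))
    rw [h']

section Projective

variable {P A B : g.SuperModule} {ι : A.carrier →ₗ[ℂ] B.carrier} {f : A.carrier →ₗ[ℂ] P.carrier}

theorem trace_homComm (hf : IsEquivariant A P f) {x : g.carrier}
    (hx : x ∈ g.part 0) (T : P.carrier →ₗ[ℂ] A.carrier) :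
    LinearMap.trace ℂ P.carrier (f ∘ₗ P.homComm A x T ∘ₗ P.pty) = 0 := by
  have h : f ∘ₗ P.homComm A x T ∘ₗ P.pty =
      P.act x * (f ∘ₗ T ∘ₗ P.pty) - (f ∘ₗ T ∘ₗ P.pty) * P.act x := by
    ext m
    simp [hf x, act_pty_of_even _ hx]
  rw [h, map_sub, LinearMap.trace_mul_comm, sub_self]

theorem trace_homPostOdd (hf : IsEquivariant A P f) {x : g.carrier}
    (T : P.carrier →ₗ[ℂ] A.carrier) :
    LinearMap.trace ℂ P.carrier (f ∘ₗ P.homPostOdd A x T ∘ₗ P.pty) = 0 := by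
  have h : f ∘ₗ P.homPostOdd A x T ∘ₗ P.pty =
      P.act x * (f ∘ₗ T) - (f ∘ₗ T) * P.act x := by
    ext m
    simp [hf x]
  rw [h, map_sub, LinearMap.trace_mul_comm, sub_self]

/-- The lift of the trace pairing provided by projectivity. -/
theorem IsProjectiveInF.exists_lift (hg : g.IsClassical) (hP : g.IsProjectiveInF P)
    (hA : A.MemF) (hB : B.MemF) (hι : IsEquivariant A B ι) (hinj : Function.Injective ι)
    (hf : IsEquivariant A P f) :
    ∃ Θ : P.carrier →ₗ[ℂ] (P.carrier →ₗ[ℂ] B.carrier) →ₗ[ℂ] P.carrier,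
      (∀ x ∈ g.part 0, ∀ p T,
        Θ (P.act x p) T = P.act x (Θ p T) - Θ p (P.homComm B x T)) ∧
      (∀ x ∈ g.part 1, ∀ p T,
        Θ (P.act x p) T = P.act x (Θ p T) + Complex.I • P.pty (Θ p (P.homPostOdd B x T))) ∧
      ∀ p T, Θ p (ι ∘ₗ T) = LinearMap.trace ℂ P.carrier (f ∘ₗ T ∘ₗ P.pty) • p := by
  have hPF := hP.1
  rw [isProjectiveInF_iff hPF] at hP
  let τ : (P.carrier →ₗ[ℂ] A.carrier) →ₗ[ℂ] ℂ :=
    LinearMap.trace ℂ P.carrier ∘ₗ LinearMap.llcomp ℂ _ _ _ f ∘ₗ LinearMap.lcomp ℂ _ P.pty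
  let Φ : P.carrier →ₗ[ℂ] (P.carrier →ₗ[ℂ] A.carrier) →ₗ[ℂ] P.carrier :=
    LinearMap.smulRightₗ τ
  have hΦ : IsEquivariant P ((P.homPost A).homPre P) Φ := by
    refine isEquivariant_of_homogeneous (fun x hx p ↦ ?_) (fun x hx p ↦ ?_)
    · rw [homPre_act_of_even hx]
      refine LinearMap.ext fun T ↦ ?_
      change τ T • P.act x p = P.act x (τ T • p) - τ ((P.homPost A).act x T) • p
      rw [homPost_act_of_even hx, show τ (P.homComm A x T) = 0 from trace_homComm hf hx T,
        zero_smul, sub_zero, map_smul]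
    · rw [homPre_act_of_odd hx]
      refine LinearMap.ext fun T ↦ ?_
      change τ T • P.act x p =
        P.act x (τ T • p) + Complex.I • P.pty (τ ((P.homPost A).act x T) • p)
      rw [homPost_act_of_odd hx, show τ (P.homPostOdd A x T) = 0 from trace_homPostOdd hf T,
        zero_smul, map_zero, smul_zero, add_zero, map_smul]
  obtain ⟨r, hr⟩ := ι.exists_leftInverse_of_injective (LinearMap.ker_eq_bot.mpr hinj)
  obtain ⟨Θ, hΘ, hΘΦ⟩ := hP _ _ ((hPF.homPost hg hB).homPre hg hPF)
    ((hPF.homPost hg hA).homPre hg hPF) _ (isEquivariant_homPre_homPost hι) (fun S ↦ by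
      refine ⟨LinearMap.lcomp ℂ P.carrier (LinearMap.llcomp ℂ P.carrier _ _ r) S, ?_⟩
      refine LinearMap.ext fun T ↦ congrArg S ?_
      change r ∘ₗ ι ∘ₗ T = T
      rw [← LinearMap.comp_assoc, hr, LinearMap.id_comp]) Φ hΦ
  refine ⟨Θ, fun x hx p T ↦ ?_, fun x hx p T ↦ ?_, fun p T ↦ ?_⟩
  · have h := hΘ x p
    rw [homPre_act_of_even hx] at h
    have h' := LinearMap.congr_fun h T
    rw [homComm_apply, homPost_act_of_even hx] at h'
    exact h'
  · have h := hΘ x p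
    rw [homPre_act_of_odd hx] at h
    have h' := LinearMap.congr_fun h T
    rw [homPreOdd_apply, homPost_act_of_odd hx] at h'
    exact h'
  · exact LinearMap.congr_fun (LinearMap.congr_fun hΘΦ p) T

section Contract

variable {n : Type} [Fintype n] (b : Basis n ℂ P.carrier)
  (Θ : P.carrier →ₗ[ℂ] (P.carrier →ₗ[ℂ] B.carrier) →ₗ[ℂ] P.carrier)

/-- Contraction of `Θ` against the endomorphism `κ`. -/
def contract (κ : Module.End ℂ P.carrier) : B.carrier →ₗ[ℂ] P.carrier :=
  ∑ j, Θ (b j) ∘ₗ LinearMap.smulRightₗ (b.coord j ∘ₗ κ)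

theorem contract_apply (κ : Module.End ℂ P.carrier) (v : B.carrier) :
    contract b Θ κ v = ∑ j, Θ (b j) ((b.coord j ∘ₗ κ).smulRight v) := by
  simp only [contract, LinearMap.sum_apply, LinearMap.comp_apply]
  rfl

theorem contract_neg (κ : Module.End ℂ P.carrier) (v : B.carrier) :
    contract b Θ (-κ) v = -contract b Θ κ v := by
  rw [contract_apply, contract_apply, ← Finset.sum_neg_distrib]
  refine Finset.sum_congr rfl fun j _ ↦ ?_
  rw [← map_neg]
  congr 1
  ext m
  simp

theorem sum_apply_smulRight (a κ : Module.End ℂ P.carrier) (v : B.carrier) :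
    ∑ j, Θ (a (b j)) ((b.coord j ∘ₗ κ).smulRight v) = contract b Θ (a * κ) v := by
  have h1 (j : n) : Θ (a (b j)) = ∑ k, b.coord k (a (b j)) • Θ (b k) := by
    conv_lhs => rw [← b.sum_repr (a (b j)), map_sum]
    exact Finset.sum_congr rfl fun k _ ↦ map_smul _ _ _
  have h2 (k : n) : (b.coord k ∘ₗ (a * κ)).smulRight v =
      ∑ j, b.coord k (a (b j)) • (b.coord j ∘ₗ κ).smulRight v := by
    ext m
    have h3 : b.coord k (a (κ m)) = ∑ j, b.coord j (κ m) * b.coord k (a (b j)) := by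
      conv_lhs => rw [← b.sum_repr (κ m), map_sum, map_sum]
      exact Finset.sum_congr rfl fun j _ ↦ by rw [map_smul, map_smul]; rfl
    rw [LinearMap.smulRight_apply, LinearMap.comp_apply, Module.End.mul_apply, h3,
      Finset.sum_smul, LinearMap.sum_apply]
    refine Finset.sum_congr rfl fun j _ ↦ ?_
    rw [LinearMap.smul_apply, LinearMap.smulRight_apply, LinearMap.comp_apply, smul_smul, mul_comm]
  rw [contract_apply]
  simp only [h1, h2, LinearMap.sum_apply, LinearMap.smul_apply, map_sum, map_smul]
  exact Finset.sum_comm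

variable {Θ}

theorem contract_even {x : g.carrier}
    (h : ∀ p T, Θ (P.act x p) T = P.act x (Θ p T) - Θ p (P.homComm B x T))
    {κ : Module.End ℂ P.carrier} (hκ : Commute (P.act x) κ) (v : B.carrier) :
    contract b Θ κ (B.act x v) = P.act x (contract b Θ κ v) := by
  have key := sum_apply_smulRight b Θ (P.act x) κ v
  have hT (j : n) : P.homComm B x ((b.coord j ∘ₗ κ).smulRight v) =
      (b.coord j ∘ₗ κ).smulRight (B.act x v) - (b.coord j ∘ₗ (κ * P.act x)).smulRight v := by
    ext m
    simp
  simp only [h, hT, map_sub, Finset.sum_sub_distrib, ← map_sum, ← contract_apply] at key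
  rw [hκ.eq] at key
  rw [← sub_eq_zero, ← neg_eq_zero, ← sub_eq_zero.mpr key]
  abel

theorem contract_odd {x : g.carrier}
    (h : ∀ p T,
      Θ (P.act x p) T = P.act x (Θ p T) + Complex.I • P.pty (Θ p (P.homPostOdd B x T)))
    (κ : Module.End ℂ P.carrier) (v : B.carrier) :
    contract b Θ (P.act x * κ) v = P.act x (contract b Θ κ v) +
      Complex.I • P.pty (contract b Θ (κ * P.pty) (B.act x v)
        - contract b Θ (κ * P.act x * P.pty) v) := by
  have key := sum_apply_smulRight b Θ (P.act x) κ v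
  have hT (j : n) : P.homPostOdd B x ((b.coord j ∘ₗ κ).smulRight v) =
      (b.coord j ∘ₗ (κ * P.pty)).smulRight (B.act x v)
        - (b.coord j ∘ₗ (κ * P.act x * P.pty)).smulRight v := by
    ext m
    simp
  simp only [h, hT, Finset.sum_add_distrib, ← Finset.smul_sum, ← map_sum,
    Finset.sum_sub_distrib, map_sub, ← contract_apply] at key
  rw [← key, map_sub]

end Contract

/-- Projective objects of `F` are injective. -/
theorem IsProjectiveInF.isInjectiveInF (hg : g.IsClassical) (hP : g.IsProjectiveInF P) :
    g.IsInjectiveInF P := by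
  have := hP.1.1
  refine (isInjectiveInF_iff hP.1).mpr fun A B hA hB ι hι hinj f hf ↦ ?_
  obtain ⟨Θ, h0, h1, hΘ⟩ := hP.exists_lift hg hA hB hι hinj hf
  let b := Module.finBasis ℂ P.carrier
  let H := contract b Θ
  let h : B.carrier →ₗ[ℂ] P.carrier := H P.pty - Complex.I • P.pty ∘ₗ H 1
  have hh : IsEquivariant B P h := by
    refine isEquivariant_of_homogeneous (fun x hx v ↦ ?_) (fun x hx v ↦ ?_)
    · have e1 : H P.pty (B.act x v) = P.act x (H P.pty v) :=
        contract_even b (h0 x hx) (LinearMap.ext fun m ↦ act_pty_of_even P hx m) v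
      have e2 : H 1 (B.act x v) = P.act x (H 1 v) :=
        contract_even b (h0 x hx) (Commute.one_right _) v
      simp [h, e1, e2, act_pty_of_even P hx]
    · have hσ : P.pty * P.act x * P.pty = -P.act x := by
        ext m
        simp [act_pty_of_odd P hx]
      have hσσ : P.pty * P.pty = 1 := by
        ext m
        simp
      have e1 := contract_odd b (h1 x hx) 1 v
      have e2 := contract_odd b (h1 x hx) P.pty v
      rw [hσ, hσσ, contract_neg] at e2
      rw [mul_one, one_mul, one_mul, e2] at e1
      have e3 := congrArg (fun p ↦ Complex.I • P.pty p) e1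
      simp only [map_add, map_sub, map_neg, map_smul, SuperVS.pty_pty, smul_add, smul_sub,
        smul_smul, Complex.I_mul_I, neg_smul, one_smul, sub_neg_eq_add, smul_neg] at e3
      change H P.pty (B.act x v) - Complex.I • P.pty (H 1 (B.act x v)) =
        P.act x (H P.pty v - Complex.I • P.pty (H 1 v))
      rw [map_sub, map_smul, act_pty_of_odd P hx]
      rw [← sub_eq_zero] at e3 ⊢
      rw [← e3]
      simp only [H]
      module
  have hι' (κ : Module.End ℂ P.carrier) (a : A.carrier) : H κ (ι a) = κ (P.pty (f a)) := by
    have h2 (j) : Θ (b j) ((b.coord j ∘ₗ κ).smulRight (ι a)) =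
        b.repr (κ (P.pty (f a))) j • b j := by
      have hc : f ∘ₗ (b.coord j ∘ₗ κ).smulRight a ∘ₗ P.pty =
          (b.coord j ∘ₗ κ ∘ₗ P.pty).smulRight (f a) := by
        ext m
        simp
      have := hΘ (b j) ((b.coord j ∘ₗ κ).smulRight a)
      rw [hc, LinearMap.trace_smulRight] at this
      have hι2 : (b.coord j ∘ₗ κ).smulRight (ι a) = ι ∘ₗ (b.coord j ∘ₗ κ).smulRight a := by
        ext m
        simp
      rw [hι2]
      exact this
    rw [show H κ (ι a) = _ from contract_apply b Θ κ (ι a), ← b.sum_repr (κ (P.pty (f a)))]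
    exact Finset.sum_congr rfl fun j _ ↦ h2 j
  refine ⟨(1 - Complex.I)⁻¹ • h, fun x v ↦ ?_, LinearMap.ext fun a ↦ ?_⟩
  · rw [LinearMap.smul_apply, hh, LinearMap.smul_apply, map_smul]
  · have hne : (1 - Complex.I) ≠ 0 := fun h ↦ by simpa using congrArg Complex.re h
    have : h (ι a) = (1 - Complex.I) • f a := by
      simp [h, hι', sub_smul]
    rw [LinearMap.comp_apply, LinearMap.smul_apply, this, smul_smul, inv_mul_cancel₀ hne, one_smul]

end Projective

end LieSuperAlgebra

namespace LieSuperAlgebra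

variable {g : LieSuperAlgebra}

open SuperModule

section Injective

variable {Q A B : g.SuperModule} {p : A.carrier →ₗ[ℂ] B.carrier} {f : Q.carrier →ₗ[ℂ] B.carrier}

/-- The extension of evaluation at `f` provided by injectivity. -/
theorem IsInjectiveInF.exists_extension (hg : g.IsClassical) (hQ : g.IsInjectiveInF Q)
    (hA : A.MemF) (hB : B.MemF) (hp : IsEquivariant A B p) (hsurj : Function.Surjective p)
    (hf : IsEquivariant Q B f) :
    ∃ Ψ : ((Q.carrier →ₗ[ℂ] A.carrier) →ₗ[ℂ] Q.carrier) →ₗ[ℂ] Q.carrier,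
      (∀ x ∈ g.part 0, ∀ S,
        Ψ (Q.act x ∘ₗ S - S ∘ₗ Q.homComm A x) = Q.act x (Ψ S)) ∧
      (∀ x ∈ g.part 1, ∀ S,
        Ψ (Q.act x ∘ₗ S + Complex.I • Q.pty ∘ₗ S ∘ₗ Q.homPostOdd A x) = Q.act x (Ψ S)) ∧
      ∀ S : (Q.carrier →ₗ[ℂ] B.carrier) →ₗ[ℂ] Q.carrier,
        Ψ (S ∘ₗ LinearMap.llcomp ℂ Q.carrier _ _ p) = S f := by
  have hQF := hQ.1
  rw [isInjectiveInF_iff hQF] at hQ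
  let ev : ((Q.carrier →ₗ[ℂ] B.carrier) →ₗ[ℂ] Q.carrier) →ₗ[ℂ] Q.carrier := LinearMap.applyₗ f
  have hev : IsEquivariant ((Q.homPost B).homPre Q) Q ev := by
    refine isEquivariant_of_homogeneous (fun x hx S ↦ ?_) (fun x hx S ↦ ?_)
    · rw [homPre_act_of_even hx]
      have h : (Q.homPost B).act x f = 0 := by
        rw [homPost_act_of_even hx]
        refine LinearMap.ext fun m ↦ ?_
        simp [hf x]
      change Q.act x (S f) - S ((Q.homPost B).act x f) = Q.act x (S f)
      rw [h, map_zero, sub_zero]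
    · rw [homPre_act_of_odd hx]
      have h : (Q.homPost B).act x f = 0 := by
        rw [homPost_act_of_odd hx]
        refine LinearMap.ext fun m ↦ ?_
        simp [hf x]
      change Q.act x (S f) + Complex.I • Q.pty (S ((Q.homPost B).act x f)) = Q.act x (S f)
      rw [h, map_zero, map_zero, smul_zero, add_zero]
  obtain ⟨r, hr⟩ := p.exists_rightInverse_of_surjective (LinearMap.range_eq_top.mpr hsurj)
  obtain ⟨Ψ, hΨ, hΨev⟩ := hQ _ _ ((hQF.homPost hg hB).homPre hg hQF)
    ((hQF.homPost hg hA).homPre hg hQF) _ (isEquivariant_homPre_homPost hp) (fun S S' h ↦ by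
      refine LinearMap.ext fun T ↦ ?_
      have h' : S (p ∘ₗ r ∘ₗ T) = S' (p ∘ₗ r ∘ₗ T) := LinearMap.congr_fun h (r ∘ₗ T)
      rwa [← LinearMap.comp_assoc, hr, LinearMap.id_comp] at h') ev hev
  refine ⟨Ψ, fun x hx S ↦ ?_, fun x hx S ↦ ?_, fun S ↦ LinearMap.congr_fun hΨev S⟩
  · have h := hΨ x S
    rw [homPre_act_of_even hx] at h
    rw [← h]
    refine congrArg Ψ (LinearMap.ext fun T ↦ ?_)
    rw [homComm_apply, homPost_act_of_even hx]
    rfl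
  · have h := hΨ x S
    rw [homPre_act_of_odd hx] at h
    rw [← h]
    refine congrArg Ψ (LinearMap.ext fun T ↦ ?_)
    rw [homPreOdd_apply, homPost_act_of_odd hx]
    rfl

/-- The map `T ↦ α (T w) • u`, as a linear function of `w`. -/
def evalSMul (α : A.carrier →ₗ[ℂ] ℂ) (u : Q.carrier) :
    Q.carrier →ₗ[ℂ] (Q.carrier →ₗ[ℂ] A.carrier) →ₗ[ℂ] Q.carrier :=
  LinearMap.mk₂ ℂ (fun w T ↦ α (T w) • u)
    (fun w w' T ↦ by simp [add_smul]) (fun c w T ↦ by simp [mul_smul])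
    (fun w S T ↦ by simp [add_smul]) (fun c w T ↦ by simp [mul_smul])

@[simp]
theorem evalSMul_apply (α : A.carrier →ₗ[ℂ] ℂ) (u w : Q.carrier)
    (T : Q.carrier →ₗ[ℂ] A.carrier) : evalSMul α u w T = α (T w) • u := rfl

section TracePairing

variable (Ψ : ((Q.carrier →ₗ[ℂ] A.carrier) →ₗ[ℂ] Q.carrier) →ₗ[ℂ] Q.carrier)

/-- The trace of `w ↦ Ψ (T ↦ α (T (κ w)) • u)`, as a bilinear function of `u` and `α`. -/
def tracePairing (κ : Module.End ℂ Q.carrier) :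
    Q.carrier →ₗ[ℂ] (A.carrier →ₗ[ℂ] ℂ) →ₗ[ℂ] ℂ :=
  LinearMap.mk₂ ℂ (fun u α ↦ LinearMap.trace ℂ Q.carrier ((Ψ ∘ₗ evalSMul α u) * κ))
    (fun u u' α ↦ by
      rw [← map_add, ← add_mul, ← LinearMap.comp_add]
      congr 4; ext; simp)
    (fun c u α ↦ by
      rw [← map_smul, ← smul_mul_assoc, ← LinearMap.comp_smul]
      congr 4; ext; simp [smul_comm c])
    (fun u α β ↦ by
      rw [← map_add, ← add_mul, ← LinearMap.comp_add]
      congr 4; ext; simp [add_smul])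
    (fun c u α ↦ by
      rw [← map_smul, ← smul_mul_assoc, ← LinearMap.comp_smul]
      congr 4; ext; simp [mul_smul])

theorem tracePairing_apply (κ : Module.End ℂ Q.carrier) (u : Q.carrier)
    (α : A.carrier →ₗ[ℂ] ℂ) : tracePairing Ψ κ u α =
      LinearMap.trace ℂ Q.carrier ((Ψ ∘ₗ evalSMul α u) * κ) := rfl

variable {Ψ}

theorem tracePairing_even {x : g.carrier}
    (h : ∀ S, Ψ (Q.act x ∘ₗ S - S ∘ₗ Q.homComm A x) = Q.act x (Ψ S))
    {κ : Module.End ℂ Q.carrier} (hκ : Commute (Q.act x) κ) (u : Q.carrier)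
    (α : A.carrier →ₗ[ℂ] ℂ) :
    tracePairing Ψ κ (Q.act x u) α = tracePairing Ψ κ u (α ∘ₗ A.act x) := by
  have key : Ψ ∘ₗ evalSMul α (Q.act x u) = Ψ ∘ₗ evalSMul (α ∘ₗ A.act x) u
      - (Ψ ∘ₗ evalSMul α u) * Q.act x + Q.act x * (Ψ ∘ₗ evalSMul α u) := by
    refine LinearMap.ext fun w ↦ ?_
    simp only [LinearMap.add_apply, LinearMap.sub_apply, Module.End.mul_apply,
      LinearMap.comp_apply]
    rw [← h, ← map_sub, ← map_add]
    congr 1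
    ext T
    simp [sub_smul]
  rw [tracePairing_apply, tracePairing_apply, key, add_mul, sub_mul, map_add, map_sub,
    mul_assoc, hκ.eq, ← mul_assoc, mul_assoc (Q.act x),
    LinearMap.trace_mul_comm ℂ (Q.act x), sub_add_cancel]

theorem tracePairing_odd {x : g.carrier}
    (h : ∀ S, Ψ (Q.act x ∘ₗ S + Complex.I • Q.pty ∘ₗ S ∘ₗ Q.homPostOdd A x) = Q.act x (Ψ S))
    (κ : Module.End ℂ Q.carrier) (u : Q.carrier) (α : A.carrier →ₗ[ℂ] ℂ) :
    tracePairing Ψ (κ * Q.act x) u α = tracePairing Ψ κ (Q.act x u) α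
      + Complex.I * tracePairing Ψ (Q.pty * κ) (Q.pty u) (α ∘ₗ A.act x)
      - Complex.I * tracePairing Ψ (Q.act x * Q.pty * κ) (Q.pty u) α := by
  have key : Q.act x * (Ψ ∘ₗ evalSMul α u) = Ψ ∘ₗ evalSMul α (Q.act x u)
      + Complex.I • ((Ψ ∘ₗ evalSMul (α ∘ₗ A.act x) (Q.pty u)) * Q.pty)
      - Complex.I • ((Ψ ∘ₗ evalSMul α (Q.pty u)) * (Q.act x * Q.pty)) := by
    refine LinearMap.ext fun w ↦ ?_
    simp only [LinearMap.add_apply, LinearMap.sub_apply, LinearMap.smul_apply,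
      Module.End.mul_apply, LinearMap.comp_apply]
    rw [← h, ← Ψ.map_smul, ← Ψ.map_smul, ← map_add, ← map_sub]
    congr 1
    ext T
    simp [sub_smul, smul_sub]
    abel
  have key' := congrArg (fun a ↦ LinearMap.trace ℂ Q.carrier (a * κ)) key
  simp only [add_mul, sub_mul, smul_mul_assoc, map_add, map_sub, map_smul, smul_eq_mul] at key'
  rw [mul_assoc, LinearMap.trace_mul_comm ℂ (Q.act x), mul_assoc, mul_assoc, mul_assoc] at key'
  exact key'

end TracePairing

/-- Injective objects of `F` are projective. -/
theorem IsInjectiveInF.isProjectiveInF (hg : g.IsClassical) (hQ : g.IsInjectiveInF Q) :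
    g.IsProjectiveInF Q := by
  have := hQ.1.1
  refine (isProjectiveInF_iff hQ.1).mpr fun A B hA hB p hp hsurj f hf ↦ ?_
  have := hA.1
  have := hB.1
  obtain ⟨Ψ, h0, h1, hΨ⟩ := hQ.exists_extension hg hA hB hp hsurj hf
  let K : Q.carrier →ₗ[ℂ] (A.carrier →ₗ[ℂ] ℂ) →ₗ[ℂ] ℂ :=
    tracePairing Ψ Q.pty ∘ₗ Q.pty + Complex.I • tracePairing Ψ 1
  have hK (u : Q.carrier) (α : A.carrier →ₗ[ℂ] ℂ) : K u α =
    tracePairing Ψ Q.pty (Q.pty u) α + Complex.I * tracePairing Ψ 1 u α := rfl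
  have hKx (x : g.carrier) (u : Q.carrier) (α : A.carrier →ₗ[ℂ] ℂ) :
      K (Q.act x u) α = K u (α ∘ₗ A.act x) := by
    have heven (x) (hx : x ∈ g.part 0) : K (Q.act x u) α = K u (α ∘ₗ A.act x) := by
      rw [hK, hK, ← act_pty_of_even Q hx, tracePairing_even (h0 x hx) (Commute.one_right _),
        tracePairing_even (h0 x hx) (LinearMap.ext fun m ↦ act_pty_of_even Q hx m)]
    have hodd (x) (hx : x ∈ g.part 1) : K (Q.act x u) α = K u (α ∘ₗ A.act x) := by
      have hσσ : Q.pty * Q.pty = 1 := by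
        ext m
        simp
      have hσx : Q.pty * Q.act x = -(Q.act x * Q.pty) := by
        ext m
        simp [act_pty_of_odd Q hx]
      have e1 := tracePairing_odd (h1 x hx) 1 u α
      have e2 := tracePairing_odd (h1 x hx) Q.pty (Q.pty u) α
      rw [one_mul, mul_one, mul_one] at e1
      rw [mul_assoc, hσσ, hσx, mul_one, SuperVS.pty_pty, act_pty_of_odd Q hx] at e2
      have hneg : tracePairing Ψ (-(Q.act x * Q.pty)) (Q.pty u) α =
          -tracePairing Ψ (Q.act x * Q.pty) (Q.pty u) α := by
        rw [tracePairing_apply, tracePairing_apply, mul_neg, map_neg]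
      rw [hneg, map_neg, LinearMap.neg_apply] at e2
      rw [hK, hK]
      have hI := Complex.I_mul_I
      linear_combination (-Complex.I) * e1 + e2
        + (tracePairing Ψ (Q.act x * Q.pty) (Q.pty u) α
          - tracePairing Ψ Q.pty (Q.pty u) (α ∘ₗ A.act x)) * hI
    obtain ⟨a, ha, b, hb, rfl⟩ := g.exists_add x
    simp only [map_add, LinearMap.add_apply, heven a ha, hodd b hb, LinearMap.comp_add]
  have hKp (u : Q.carrier) (β : B.carrier →ₗ[ℂ] ℂ) :
      K u (β ∘ₗ p) = (1 + Complex.I) * β (f u) := by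
    have hG (κ : Module.End ℂ Q.carrier) (u : Q.carrier) :
        tracePairing Ψ κ u (β ∘ₗ p) = β (f (κ u)) := by
      have : (Ψ ∘ₗ evalSMul (β ∘ₗ p) u) * κ = (β ∘ₗ f ∘ₗ κ).smulRight u := by
        refine LinearMap.ext fun w ↦ ?_
        exact hΨ (evalSMul β u (κ w))
      rw [tracePairing_apply, this, LinearMap.trace_smulRight]
      rfl
    rw [hK, hG, hG, SuperVS.pty_pty, Module.End.one_apply]
    ring
  have hne : (1 + Complex.I) ≠ 0 := fun h ↦ by simpa using congrArg Complex.re h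
  let h : Q.carrier →ₗ[ℂ] A.carrier :=
    (1 + Complex.I)⁻¹ • (Module.evalEquiv ℂ A.carrier).symm.toLinearMap ∘ₗ K
  have hh (u : Q.carrier) (α : A.carrier →ₗ[ℂ] ℂ) : α (h u) = (1 + Complex.I)⁻¹ * K u α := by
    simp [h]
  refine ⟨h, fun x u ↦ ?_, LinearMap.ext fun u ↦ ?_⟩
  · rw [← sub_eq_zero]
    refine (Module.forall_dual_apply_eq_zero_iff ℂ _).mp fun α ↦ ?_
    rw [map_sub, hh, hKx, ← hh u (α ∘ₗ A.act x), LinearMap.comp_apply, sub_self]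
  · rw [← sub_eq_zero]
    refine (Module.forall_dual_apply_eq_zero_iff ℂ _).mp fun β ↦ ?_
    rw [map_sub, LinearMap.comp_apply, ← LinearMap.comp_apply β p, hh, hKp,
      inv_mul_cancel_left₀ hne, sub_self]

end Injective

end LieSuperAlgebra

/-!
STATEMENT 1: For a classical Lie superalgebra `g` and `M` in `F = F(g, g₀̄)`,
`M` is projective in `F` if and only if `M` is injective in `F`.
-/

open LieSuperAlgebra in
theorem projective_iff_injective_in_F
    (g : LieSuperAlgebra) (hg : g.IsClassical)
    (M : g.SuperModule) (hM : M.MemF) :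
    g.IsProjectiveInF M ↔ g.IsInjectiveInF M := by
  exact ⟨fun h ↦ h.isInjectiveInF hg, fun h ↦ h.isProjectiveInF hg⟩
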